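/- arXiv:2603.17819 — 5 statements merged into one kernel-verified Lean document; each statement's English description precedes it below -/
import Mathlib

section
/- Let k ≥ 2 and let (A_n)_{n∈ℤ} be a sequence of k×k matrices with nonnegative integer entries of the form (A_n)_{i,j} = a_{n,j} if i = 1; 1 if i = j+1; 0 otherwise, where a_{n,1} ≥ 1 for all n. Assume there exist a k×k matrix P with all entries positive and indices i_1 < j_1 ≤ i_2 < j_2 ≤ ⋯ in ℕ with A_{j_r−1}⋯A_{i_r} = P for every r ≥ 1. Let (γ_n)_{n∈ℤ} be positive reals and (f_n)_{n∈ℤ} row vectors in ℝ_{≥0}^k with first entry 1 satisfying γ_n·f_{n−1} = f_n·A_n for all n ∈ ℤ. Then for all n ∈ ℤ: (1) γ_n ≥ 1; (2) 1 = ∑_{j=1}^{k} a_{n+j,j}/(γ_{n+1}⋯γ_{n+j}). If moreover a_{n,k} ≥ 1 for all n ∈ ℤ, then γ_n > 1 for all n ∈ ℤ. -/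
/-- The product `A (j-1) * A (j-2) * ⋯ * A i` of a `ℤ`-indexed sequence of matrices
(the empty product being the identity). -/
def matProdZ (k : ℕ) (A : ℤ → Matrix (Fin k) (Fin k) ℕ) (i j : ℤ) :
    Matrix (Fin k) (Fin k) ℕ :=
  ((List.range (j - i).toNat).map (fun m => A (j - 1 - m))).prod

/-- A row vector indexed by `Fin k`, extended by zero to all natural indices. -/
def extendByZero {k : ℕ} (v : Fin k → ℝ) (j : ℕ) : ℝ :=
  if h : j < k then v ⟨j, h⟩ else 0

theorem extendByZero_nonneg {k : ℕ} {v : Fin k → ℝ} (hv : ∀ i, 0 ≤ v i) (j : ℕ) :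
    0 ≤ extendByZero v j := by
  unfold extendByZero
  split_ifs
  exacts [hv _, le_rfl]

/-- Multiplying a row vector by a companion matrix shifts it and adds a multiple of the
first row of the matrix. -/
theorem vecMul_companion {k : ℕ} (b : ℕ → ℕ) (B : Matrix (Fin k) (Fin k) ℕ)
    (hB : ∀ i j : Fin k, B i j =
      if (i : ℕ) = 0 then b ((j : ℕ) + 1)
      else if (i : ℕ) = (j : ℕ) + 1 then 1
      else 0) (v : Fin k → ℝ) (j : Fin k) :
    Matrix.vecMul v (B.map (Nat.cast : ℕ → ℝ)) j =
      extendByZero v 0 * b ((j : ℕ) + 1) + extendByZero v ((j : ℕ) + 1) := by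
  let g (i : ℕ) : ℝ := (if i = 0 then extendByZero v 0 * (b ((j : ℕ) + 1) : ℝ) else 0) +
    if i = (j : ℕ) + 1 then extendByZero v ((j : ℕ) + 1) else 0
  have hterm (i : Fin k) : v i * (B.map (Nat.cast : ℕ → ℝ)) i j = g i := by
    have hv : v i = extendByZero v (i : ℕ) := by simp [extendByZero]
    rw [Matrix.map_apply, hB, hv]
    by_cases h0 : (i : ℕ) = 0
    · simp [g, h0]
    · by_cases h1 : (i : ℕ) = (j : ℕ) + 1 <;> simp [g, h0, h1]
  rw [Matrix.vecMul, dotProduct, Finset.sum_congr rfl fun i _ => hterm i,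
    Fin.sum_univ_eq_sum_range g k, Finset.sum_add_distrib, Finset.sum_ite_eq', Finset.sum_ite_eq',
    if_pos (Finset.mem_range.2 (by have := j.isLt; omega))]
  by_cases h : (j : ℕ) + 1 < k
  · rw [if_pos (Finset.mem_range.2 h)]
  · simp [extendByZero, h]

/-- Iterating the recurrence `γ n * F (n - 1) j = b n (j + 1) + F n (j + 1)`. -/
theorem eq_sum_div_prod_add {k : ℕ} {γ : ℤ → ℝ} (hγ : ∀ n, γ n ≠ 0)
    {b F : ℤ → ℕ → ℝ}
    (hF : ∀ n j, j < k → γ n * F (n - 1) j = b n (j + 1) + F n (j + 1))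
    (n : ℤ) {m : ℕ} (hm : m ≤ k) :
    F n 0 = (∑ j ∈ Finset.range m,
        b (n + 1 + j) (j + 1) / ∏ i ∈ Finset.range (j + 1), γ (n + 1 + i)) +
      F (n + m) m / ∏ i ∈ Finset.range m, γ (n + 1 + i) := by
  induction m with
  | zero => simp
  | succ m ih =>
    have h := hF (n + 1 + m) m hm
    rw [show n + 1 + (m : ℤ) - 1 = n + m by ring] at h
    rw [ih (Nat.le_of_succ_le hm), Finset.sum_range_succ, add_assoc, ← add_div,
      show n + ((m + 1 : ℕ) : ℤ) = n + 1 + m by push_cast; ring, ← h,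
      Finset.prod_range_succ, mul_comm (γ _), mul_div_mul_right _ _ (hγ _)]

theorem stmt11 (k : ℕ) (hk : 2 ≤ k)
    (a : ℤ → ℕ → ℕ) (ha1 : ∀ n : ℤ, 1 ≤ a n 1)
    (A : ℤ → Matrix (Fin k) (Fin k) ℕ)
    (hA : ∀ n : ℤ, ∀ i j : Fin k, A n i j =
      if (i : ℕ) = 0 then a n ((j : ℕ) + 1)
      else if (i : ℕ) = (j : ℕ) + 1 then 1
      else 0)
    (P : Matrix (Fin k) (Fin k) ℕ) (hP : ∀ i j, 0 < P i j)
    (idx jdx : ℕ → ℕ)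
    (hij : ∀ r, idx r < jdx r) (hji : ∀ r, jdx r ≤ idx (r + 1))
    (hprod : ∀ r, matProdZ k A (idx r) (jdx r) = P)
    (γ : ℤ → ℝ) (f : ℤ → Fin k → ℝ)
    (hγpos : ∀ n, 0 < γ n) (hfpos : ∀ n i, 0 ≤ f n i)
    (hf1 : ∀ n, f n ⟨0, by omega⟩ = 1)
    (hrec : ∀ n : ℤ, γ n • f (n - 1) =
      Matrix.vecMul (f n) ((A n).map (Nat.cast : ℕ → ℝ))) :
    (∀ n : ℤ,
      (1 ≤ γ n) ∧
      ((1 : ℝ) = ∑ j ∈ Finset.range k,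
          (a (n + 1 + j) (j + 1) : ℝ) / ∏ i ∈ Finset.range (j + 1), γ (n + 1 + i))) ∧
    ((∀ n : ℤ, 1 ≤ a n k) → ∀ n : ℤ, 1 < γ n) := by
  have hrecF (n : ℤ) (j : ℕ) (hj : j < k) :
      γ n * extendByZero (f (n - 1)) j =
        (a n (j + 1) : ℝ) + extendByZero (f n) (j + 1) := by
    have h := congrFun (hrec n) ⟨j, hj⟩
    rw [vecMul_companion (a n) (A n) (hA n)] at h
    simpa [extendByZero, hj, hf1, show 0 < k by omega] using h
  have hF0 (n : ℤ) : extendByZero (f n) 0 = 1 := by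
    simp [extendByZero, hf1, show 0 < k by omega]
  have hγ (n : ℤ) : γ n = (a n 1 : ℝ) + extendByZero (f n) 1 := by
    simpa [hF0] using hrecF n 0 (by omega)
  have ha1' (n : ℤ) : (1 : ℝ) ≤ a n 1 := by exact_mod_cast ha1 n
  refine ⟨fun n => ⟨?_, ?_⟩, fun hak n => ?_⟩
  · linarith [hγ n, ha1' n, extendByZero_nonneg (hfpos n) 1]
  · have h := eq_sum_div_prod_add (b := fun n j => (a n j : ℝ))
      (F := fun n => extendByZero (f n)) (fun n => (hγpos n).ne') hrecF n le_rfl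
    simpa [hF0, show extendByZero (f (n + k)) k = 0 by simp [extendByZero]] using h
  · have hpos (d : ℕ) : ∀ (j : ℕ) (n : ℤ), j + d + 1 = k → 0 < extendByZero (f n) j := by
      induction d with
      | zero =>
        intro j n hj
        have h := hrecF (n + 1) j (by omega)
        have hb : (1 : ℝ) ≤ a (n + 1) (j + 1) := by
          rw [show j + 1 = k by omega]
          exact_mod_cast hak (n + 1)
        rw [add_sub_cancel_right] at h
        refine pos_of_mul_pos_right (a := γ (n + 1)) ?_ (hγpos _).le
        linarith [extendByZero_nonneg (hfpos (n + 1)) (j + 1)]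
      | succ d ih =>
        intro j n hj
        have h := hrecF (n + 1) j (by omega)
        rw [add_sub_cancel_right] at h
        refine pos_of_mul_pos_right (a := γ (n + 1)) ?_ (hγpos _).le
        rw [h]
        exact add_pos_of_nonneg_of_pos (Nat.cast_nonneg _) (ih (j + 1) (n + 1) (by omega))
    linarith [hγ n, ha1' n, hpos (k - 2) 1 n (by omega)]
end

section
/- Let p ≥ 1 and for each i ∈ {0,…,p−1} let 𝐚_i = a_{i,1}a_{i,2}⋯ be an ultimately periodic sequence of nonnegative integers with a_{i,1} ≥ 1 and not eventually zero. Then there exist real numbers β_0,…,β_{p−1}, all greater than 1, such that for every i ∈ {0,…,p−1}: ∑_{j=1}^{∞} a_{i,j}/(β_{(i−1) mod p}·β_{(i−2) mod p}⋯β_{(i−j) mod p}) = 1. -/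
open Filter Topology Finset

section CyclicExpansion

variable {p : ℕ}

/-- The product `β (i-1) * β (i-2) * ⋯ * β (i-1-j)` of `j + 1` cyclically indexed factors. -/
noncomputable def cyclicDenom (β : ZMod p → ℝ) (i : ZMod p) (j : ℕ) : ℝ :=
  ∏ m ∈ range (j + 1), β (i - 1 - m)

lemma cyclicDenom_zero (β : ZMod p → ℝ) (i : ZMod p) : cyclicDenom β i 0 = β (i - 1) := by
  simp [cyclicDenom]

lemma cyclicDenom_succ (β : ZMod p → ℝ) (i : ZMod p) (j : ℕ) :
    cyclicDenom β i (j + 1) = cyclicDenom β i j * β (i - 1 - (j + 1 : ℕ)) :=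
  prod_range_succ _ _

lemma cyclicDenom_pos {β : ZMod p → ℝ} (hβ : ∀ i, 0 < β i) (i : ZMod p) (j : ℕ) :
    0 < cyclicDenom β i j :=
  prod_pos fun _ _ => hβ _

lemma pow_le_cyclicDenom {β : ZMod p → ℝ} {γ : ℝ} (hγ : 0 ≤ γ) (hβ : ∀ i, γ ≤ β i)
    (i : ZMod p) (j : ℕ) : γ ^ (j + 1) ≤ cyclicDenom β i j := by
  calc γ ^ (j + 1) = ∏ _m ∈ range (j + 1), γ := by simp
    _ ≤ _ := prod_le_prod (fun _ _ => hγ) fun _ _ => hβ _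

lemma cyclicDenom_const_mul (t : ℝ) (β : ZMod p → ℝ) (i : ZMod p) (j : ℕ) :
    cyclicDenom (fun k => t * β k) i j = t ^ (j + 1) * cyclicDenom β i j := by
  simp [cyclicDenom, prod_mul_distrib]

/-- Rescaling by a coboundary changes the denominators only through the end points. -/
lemma cyclicDenom_coboundary (β d : ZMod p → ℝ) (hd : ∀ i, 0 < d i) (i : ZMod p) (j : ℕ) :
    cyclicDenom (fun k => β k * d (k + 1) / d k) i j
      = cyclicDenom β i j * d i / d (i - 1 - j) := by
  induction j with
  | zero => simp [cyclicDenom_zero]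
  | succ j ih =>
    have e : i - 1 - ((j + 1 : ℕ) : ZMod p) + 1 = i - 1 - j := by push_cast; ring
    rw [cyclicDenom_succ, cyclicDenom_succ, ih, e]
    have := (hd (i - 1 - j)).ne'
    have := (hd (i - 1 - (j + 1 : ℕ))).ne'
    field_simp

/-- The positive `β` for which every partial sum of every row is at most `1`. -/
def IsSupersolution (a : ZMod p → ℕ → ℝ) (β : ZMod p → ℝ) : Prop :=
  (∀ i, 0 < β i) ∧ ∀ i N, ∑ j ∈ range N, a i j / cyclicDenom β i j ≤ 1

variable {a : ZMod p → ℕ → ℝ}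

lemma IsSupersolution.summable (ha : ∀ i j, 0 ≤ a i j) {β : ZMod p → ℝ}
    (h : IsSupersolution a β) (i : ZMod p) : Summable fun j => a i j / cyclicDenom β i j :=
  summable_of_sum_range_le (fun j => div_nonneg (ha i j) (cyclicDenom_pos h.1 i j).le) (h.2 i)

lemma IsSupersolution.tsum_le_one (ha : ∀ i j, 0 ≤ a i j) {β : ZMod p → ℝ}
    (h : IsSupersolution a β) (i : ZMod p) : ∑' j, a i j / cyclicDenom β i j ≤ 1 :=
  Real.tsum_le_of_sum_range_le
    (fun j => div_nonneg (ha i j) (cyclicDenom_pos h.1 i j).le) (h.2 i)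

lemma isSupersolution_of_tsum_le_one (ha : ∀ i j, 0 ≤ a i j) {β : ZMod p → ℝ}
    (hβ : ∀ i, 0 < β i) (hs : ∀ i, Summable fun j => a i j / cyclicDenom β i j)
    (h : ∀ i, ∑' j, a i j / cyclicDenom β i j ≤ 1) : IsSupersolution a β :=
  ⟨hβ, fun i N => ((hs i).sum_le_tsum (range N)
    fun j _ => div_nonneg (ha i j) (cyclicDenom_pos hβ i j).le).trans (h i)⟩

lemma IsSupersolution.one_lt (ha : ∀ i j, 0 ≤ a i j) (ha0 : ∀ i, 1 ≤ a i 0)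
    (hne : ∀ i, ∃ j, 0 < a i (j + 1)) {β : ZMod p → ℝ}
    (h : IsSupersolution a β) (i : ZMod p) : 1 < β i := by
  obtain ⟨j, hj⟩ := hne (i + 1)
  have h1 := h.2 (i + 1) (j + 1 + 1)
  rw [sum_range_succ, sum_range_succ'] at h1
  have h2 : 0 ≤ ∑ k ∈ range j, a (i + 1) (k + 1) / cyclicDenom β (i + 1) (k + 1) :=
    sum_nonneg fun k _ => div_nonneg (ha _ _) (cyclicDenom_pos h.1 _ _).le
  have h3 := div_pos hj (cyclicDenom_pos h.1 (i + 1) (j + 1))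
  have h4 : a (i + 1) 0 / β i < 1 := by
    rw [cyclicDenom_zero, add_sub_cancel_right] at h1
    linarith
  rw [div_lt_one (h.1 i)] at h4
  exact (ha0 _).trans_lt h4

lemma isSupersolution_const {B : ℝ} (hB : 1 ≤ B) (haB : ∀ i j, a i j ≤ B) :
    IsSupersolution a fun _ => B + 1 := by
  refine ⟨fun _ => by linarith, fun i N => ?_⟩
  have key : ∑ j ∈ range N, B / (B + 1) ^ (j + 1) = 1 - 1 / (B + 1) ^ N := by
    have : B + 1 ≠ 0 := by linarith
    induction N with
    | zero => simp
    | succ n ih =>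
      rw [sum_range_succ, ih]
      field_simp
      ring
  calc _ ≤ ∑ j ∈ range N, B / (B + 1) ^ (j + 1) := by
        refine sum_le_sum fun j _ => ?_
        simp only [cyclicDenom, prod_const, card_range]
        have : 0 < (B + 1) ^ (j + 1) := by positivity
        gcongr
        exact haB i j
    _ ≤ 1 := by
        rw [key]
        have : 0 ≤ 1 / (B + 1) ^ N := by positivity
        linarith

/-- If one row sum is less than `1`, a coboundary rescaling makes all of them less than `1`. -/
lemma IsSupersolution.exists_strict [NeZero p] (ha : ∀ i j, 0 ≤ a i j) (ha0 : ∀ i, 1 ≤ a i 0)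
    {β : ZMod p → ℝ} (h : IsSupersolution a β) {i₀ : ZMod p}
    (hi₀ : ∑' j, a i₀ j / cyclicDenom β i₀ j < 1) :
    ∃ β', IsSupersolution a β' ∧ (∀ i, ∑' j, a i j / cyclicDenom β' i j < 1) ∧
      ∏ i, β' i = ∏ i, β i := by
  set w : ZMod p → ℕ → ℝ := fun i j => a i j / cyclicDenom β i j with hw
  have w_nonneg : ∀ i j, 0 ≤ w i j := fun i j => div_nonneg (ha i j) (cyclicDenom_pos h.1 i j).le
  have w_summable : ∀ i, Summable (w i) := h.summable ha
  have w_le : ∀ i, ∑' j, w i j ≤ 1 := h.tsum_le_one ha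
  have w_zero_pos : ∀ i, 0 < w i 0 := fun i =>
    div_pos (zero_lt_one.trans_le (ha0 i)) (cyclicDenom_pos h.1 i 0)
  obtain ⟨i₁, hi₁⟩ := Finite.exists_min fun i => w i 0
  obtain ⟨c, hc⟩ : ∃ c, c = w i₁ 0 / 2 := ⟨_, rfl⟩
  have hc0 : 0 < c := by have := w_zero_pos i₁; linarith
  have hcw : ∀ i, c < w i 0 := fun i => by have := hi₁ i; have := w_zero_pos i₁; linarith
  have hc1 : c ≤ 1 := by
    have := (w_summable i₁).le_tsum 0 fun j _ => w_nonneg i₁ j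
    have := w_le i₁
    linarith
  obtain ⟨ε, hε⟩ : ∃ ε, ε = (1 - ∑' j, w i₀ j) / 2 := ⟨_, rfl⟩
  have hε0 : 0 < ε := by change ∑' j, w i₀ j < 1 at hi₀; linarith
  have hε1 : ε < 1 := by have : 0 ≤ ∑' j, w i₀ j := tsum_nonneg (w_nonneg i₀); linarith
  set d : ZMod p → ℝ := fun i => 1 - ε * c ^ (i - i₀).val with hd
  have d_le : ∀ i, d i ≤ 1 := fun i => by
    have : 0 < ε * c ^ (i - i₀).val := by positivity
    simp only [hd]; linarith
  have d_pos : ∀ i, 0 < d i := fun i => by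
    have h1 : c ^ (i - i₀).val ≤ 1 := pow_le_one₀ hc0.le hc1
    have : ε * c ^ (i - i₀).val ≤ ε := mul_le_of_le_one_right hε0.le h1
    simp only [hd]; linarith
  have wd_summable : ∀ i, Summable fun j : ℕ => w i j * d (i - 1 - j) := fun i =>
    (w_summable i).of_nonneg_of_le (fun j => mul_nonneg (w_nonneg i j) (d_pos _).le)
      fun j => mul_le_of_le_one_right (w_nonneg i j) (d_le _)
  have wd_lt : ∀ i, ∑' j : ℕ, w i j * d (i - 1 - j) < d i := by
    intro i
    by_cases hi : i = i₀
    · subst hi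
      calc ∑' j : ℕ, w i j * d (i - 1 - j) ≤ ∑' j, w i j :=
            (wd_summable i).tsum_le_tsum
              (fun j => mul_le_of_le_one_right (w_nonneg i j) (d_le _)) (w_summable i)
        _ < d i := by simp only [hd, sub_self, ZMod.val_zero, pow_zero]; linarith
    · have e : ∑' j : ℕ, w i j * (1 - d (i - 1 - j))
          = ∑' j, w i j - ∑' j : ℕ, w i j * d (i - 1 - j) := by
        rw [← (w_summable i).tsum_sub (wd_summable i)]
        exact tsum_congr fun j => by ring
      have hs : Summable fun j : ℕ => w i j * (1 - d (i - 1 - j)) :=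
        ((w_summable i).sub (wd_summable i)).congr fun j => by ring
      have h0 := hs.le_tsum 0 fun j _ => mul_nonneg (w_nonneg i j) (sub_nonneg.2 (d_le _))
      have hval : (i - i₀).val = (i - 1 - i₀).val + 1 := by
        have hne : i - i₀ ≠ 0 := sub_ne_zero.2 hi
        have hpos : 1 ≤ (i - i₀).val := Nat.one_le_iff_ne_zero.2 ((ZMod.val_ne_zero _).2 hne)
        have : i - 1 - i₀ = (((i - i₀).val - 1 : ℕ) : ZMod p) := by
          rw [Nat.cast_sub hpos, ZMod.natCast_zmod_val]
          push_cast; ring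
        rw [this, ZMod.val_cast_of_lt]
        · omega
        · have := ZMod.val_lt (i - i₀); omega
      have hdi : d i = 1 - c * (1 - d (i - 1)) := by
        simp only [hd]; rw [hval, pow_succ]; ring
      have hpos : 0 < 1 - d (i - 1) := by
        simp only [hd, sub_sub_cancel]; positivity
      have := mul_lt_mul_of_pos_right (hcw i) hpos
      have := w_le i
      simp only [Nat.cast_zero, sub_zero] at h0
      linarith
  have β'_pos : ∀ i, 0 < β i * d (i + 1) / d i := fun i =>
    div_pos (mul_pos (h.1 i) (d_pos _)) (d_pos _)
  have e : ∀ i, (fun j => a i j / cyclicDenom (fun k => β k * d (k + 1) / d k) i j)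
      = fun j : ℕ => w i j * d (i - 1 - j) / d i := by
    intro i
    funext j
    rw [cyclicDenom_coboundary β d d_pos]
    have := (d_pos i).ne'
    have := (d_pos (i - 1 - j)).ne'
    have := (cyclicDenom_pos h.1 i j).ne'
    simp only [hw]
    field_simp
  have lt_one : ∀ i, ∑' j, a i j / cyclicDenom (fun k => β k * d (k + 1) / d k) i j < 1 := by
    intro i
    rw [e i, tsum_div_const, div_lt_one (d_pos i)]
    exact wd_lt i
  refine ⟨fun k => β k * d (k + 1) / d k, isSupersolution_of_tsum_le_one ha β'_pos
    (fun i => by rw [e i]; exact (wd_summable i).div_const _) fun i => (lt_one i).le, lt_one, ?_⟩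
  have hprod : ∏ i, d (i + 1) = ∏ i, d i := Equiv.prod_comp (Equiv.addRight 1) d
  rw [prod_div_distrib, prod_mul_distrib, hprod]
  exact mul_div_cancel_right₀ _ (prod_pos fun i _ => d_pos i).ne'

/-- If all row sums are less than `1`, then `β` can be shrunk by a constant factor. -/
lemma IsSupersolution.exists_shrink [NeZero p] (ha : ∀ i j, 0 ≤ a i j) {B : ℝ}
    (haB : ∀ i j, a i j ≤ B) {β : ZMod p → ℝ} (hβ : ∀ i, 1 < β i)
    (h : ∀ i, ∑' j, a i j / cyclicDenom β i j < 1) :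
    ∃ t : ℝ, 0 < t ∧ t < 1 ∧ IsSupersolution a fun i => t * β i := by
  obtain ⟨i₁, hi₁⟩ := Finite.exists_min β
  set γ := β i₁
  have hγ : 1 < γ := hβ i₁
  have hB : 0 ≤ B := (ha 0 0).trans (haB 0 0)
  obtain ⟨r, hr⟩ : ∃ r, r = (1 + γ) / 2 := ⟨_, rfl⟩
  have hr1 : 1 < r := by linarith
  have ht₀ : r / γ < 1 := by rw [div_lt_one (by linarith)]; linarith
  have ht₀' : 0 < r / γ := by positivity
  have bound_summable : Summable fun j : ℕ => B / r ^ (j + 1) := by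
    have : Summable fun j : ℕ => (B / r) * (1 / r) ^ j :=
      (summable_geometric_of_lt_one (by positivity)
        (by rw [div_lt_one (by linarith)]; exact hr1)).mul_left _
    refine this.congr fun j => ?_
    rw [div_pow, one_pow, pow_succ]
    field_simp
  have bound : ∀ t, r / γ < t → ∀ i j,
      a i j / cyclicDenom (fun k => t * β k) i j ≤ B / r ^ (j + 1) := by
    intro t ht i j
    have hle : ∀ k, r ≤ t * β k := fun k => by
      rw [div_lt_iff₀ (by linarith)] at ht
      exact ht.le.trans (mul_le_mul_of_nonneg_left (hi₁ k) (by nlinarith))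
    exact div_le_div₀ hB (haB i j) (by positivity) (pow_le_cyclicDenom (by linarith) hle i j)
  have near : ∀ᶠ t in 𝓝[<] (1 : ℝ), r / γ < t :=
    nhdsWithin_le_nhds (lt_mem_nhds ht₀)
  have nonneg : ∀ t, r / γ < t → ∀ i j,
      0 ≤ a i j / cyclicDenom (fun k => t * β k) i j := fun t ht i j =>
    div_nonneg (ha i j) (cyclicDenom_pos
      (fun k => mul_pos (ht₀'.trans ht) (zero_lt_one.trans (hβ k))) i j).le
  have lim : ∀ i, Tendsto (fun t : ℝ => ∑' j, a i j / cyclicDenom (fun k => t * β k) i j)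
      (𝓝[<] 1) (𝓝 (∑' j, a i j / cyclicDenom β i j)) := by
    intro i
    refine tendsto_tsum_of_dominated_convergence bound_summable (fun j => ?_) ?_
    · have hne := (cyclicDenom_pos (fun k => zero_lt_one.trans (hβ k)) i j).ne'
      have : ContinuousAt (fun t : ℝ => a i j / (t ^ (j + 1) * cyclicDenom β i j)) 1 :=
        continuousAt_const.div (by fun_prop) (by simpa using hne)
      have := this.tendsto.mono_left (nhdsWithin_le_nhds (s := Set.Iio 1))
      simpa [cyclicDenom_const_mul] using this
    · filter_upwards [near] with t ht j
      rw [Real.norm_of_nonneg (nonneg t ht i j)]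
      exact bound t ht i j
  have ev : ∀ᶠ t in 𝓝[<] (1 : ℝ),
      ∀ i, ∑' j, a i j / cyclicDenom (fun k => t * β k) i j < 1 :=
    eventually_all.2 fun i => (lim i).eventually_lt_const (h i)
  obtain ⟨t, ht1, ht2, ht3⟩ := (ev.and (near.and self_mem_nhdsWithin)).exists
  refine ⟨t, ht₀'.trans ht2, ht3, isSupersolution_of_tsum_le_one ha
    (fun k => mul_pos (ht₀'.trans ht2) (zero_lt_one.trans (hβ k))) (fun i => ?_)
    fun i => (ht1 i).le⟩
  exact bound_summable.of_nonneg_of_le (nonneg t ht2 i) (bound t ht2 i)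

/-- Among all supersolutions, one minimizes the product `∏ i, β i`. -/
lemma exists_isSupersolution_prod_le [NeZero p] (ha : ∀ i j, 0 ≤ a i j) {B : ℝ} (hB : 1 ≤ B)
    (haB : ∀ i j, a i j ≤ B) (ha0 : ∀ i, 1 ≤ a i 0) (hne : ∀ i, ∃ j, 0 < a i (j + 1)) :
    ∃ β, IsSupersolution a β ∧ ∀ β', IsSupersolution a β' → ∏ i, β i ≤ ∏ i, β' i := by
  set C : ℝ := ∏ _i : ZMod p, (B + 1)
  set box : Set (ZMod p → ℝ) := Set.Icc (fun _ => 1) (fun _ => C)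
  have box_pos : ∀ β ∈ box, ∀ i, 0 < β i := fun β hβ i => zero_lt_one.trans_le (hβ.1 i)
  set K : Set (ZMod p → ℝ) :=
    {β ∈ box | ∀ i N, ∑ j ∈ range N, a i j / cyclicDenom β i j ≤ 1}
  have box_closed : IsClosed box := isClosed_Icc
  have K_eq : K = box ∩
      ⋂ i, ⋂ N, {β ∈ box | ∑ j ∈ range N, a i j / cyclicDenom β i j ≤ 1} := by
    ext β
    simp only [K, Set.mem_inter_iff, Set.mem_iInter, Set.mem_ofPred_eq]
    exact ⟨fun h => ⟨h.1, fun i N => ⟨h.1, h.2 i N⟩⟩, fun h => ⟨h.1, fun i N => (h.2 i N).2⟩⟩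
  have K_closed : IsClosed
      (⋂ i, ⋂ N, {β ∈ box | ∑ j ∈ range N, a i j / cyclicDenom β i j ≤ 1}) := by
    refine isClosed_iInter fun i => isClosed_iInter fun N =>
      box_closed.isClosed_le (continuousOn_finsetSum _ fun j _ => ?_) continuousOn_const
    refine continuousOn_const.div ?_ fun β hβ => (cyclicDenom_pos (box_pos β hβ) i j).ne'
    unfold cyclicDenom
    fun_prop
  have K_compact : IsCompact K := K_eq ▸ isCompact_Icc.inter_right K_closed
  have mem_K : ∀ β, IsSupersolution a β → ∏ i, β i ≤ C → β ∈ K := by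
    intro β hβ hle
    have h1 := hβ.one_lt ha ha0 hne
    refine ⟨⟨fun i => (h1 i).le, fun i => le_trans ?_ hle⟩, hβ.2⟩
    rw [← mul_prod_erase univ β (mem_univ i)]
    refine le_mul_of_one_le_right (hβ.1 i).le ?_
    calc (1 : ℝ) = ∏ _k ∈ univ.erase i, 1 := prod_const_one.symm
      _ ≤ _ := prod_le_prod (fun _ _ => zero_le_one) fun k _ => (h1 k).le
  have const_mem := mem_K _ (isSupersolution_const hB haB) le_rfl
  obtain ⟨β, hβK, hmin⟩ := K_compact.exists_isMinOn ⟨_, const_mem⟩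
    (f := fun β => ∏ i, β i) (by fun_prop)
  refine ⟨β, ⟨box_pos β hβK.1, hβK.2⟩, fun β' h' => ?_⟩
  rcases le_total (∏ i, β' i) C with hle | hle
  · exact hmin (mem_K β' h' hle)
  · exact (hmin const_mem).trans hle

theorem exists_cyclic_expansion_eq_one [NeZero p] (ha : ∀ i j, 0 ≤ a i j) {B : ℝ} (hB : 1 ≤ B)
    (haB : ∀ i j, a i j ≤ B) (ha0 : ∀ i, 1 ≤ a i 0) (hne : ∀ i, ∃ j, 0 < a i (j + 1)) :
    ∃ β : ZMod p → ℝ, (∀ i, 1 < β i) ∧ ∀ i, ∑' j, a i j / cyclicDenom β i j = 1 := by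
  obtain ⟨β, hβ, hmin⟩ := exists_isSupersolution_prod_le ha hB haB ha0 hne
  refine ⟨β, hβ.one_lt ha ha0 hne, fun i => ?_⟩
  by_contra hi
  obtain ⟨β', hβ', hlt, hprod⟩ :=
    hβ.exists_strict ha ha0 (lt_of_le_of_ne (hβ.tsum_le_one ha i) hi)
  obtain ⟨t, ht0, ht1, ht⟩ :=
    IsSupersolution.exists_shrink ha haB (hβ'.one_lt ha ha0 hne) hlt
  have h1 := hmin _ ht
  have h2 : t ^ p < 1 := pow_lt_one₀ ht0.le ht1 (NeZero.ne p)
  rw [prod_mul_distrib, hprod, prod_const, card_univ, ZMod.card] at h1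
  have : 0 < ∏ i, β i := prod_pos fun i _ => hβ.1 i
  nlinarith

end CyclicExpansion

/-- An ultimately periodic sequence of natural numbers is bounded. -/
lemma exists_le_of_ultimately_periodic {u : ℕ → ℕ} {m q : ℕ} (hq : 1 ≤ q)
    (h : ∀ j, m ≤ j → u (j + q) = u j) : ∃ B, ∀ j, u j ≤ B := by
  refine ⟨∑ k ∈ range (m + q), u k, fun j => ?_⟩
  induction j using Nat.strong_induction_on with
  | _ j ih =>
    rcases lt_or_ge j (m + q) with hj | hj
    · exact single_le_sum (f := u) (fun _ _ => Nat.zero_le _) (mem_range.2 hj)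
    · have := h (j - q) (by omega)
      rw [Nat.sub_add_cancel (by omega)] at this
      rw [this]
      exact ih _ (by omega)

theorem stmt13 (p : ℕ) (hp : 1 ≤ p)
    (a : ℕ → ℕ → ℕ)  -- `a i j` is the digit `a_{i,j+1}`
    (ha1 : ∀ i < p, 1 ≤ a i 0)
    (hup : ∀ i < p, ∃ m q : ℕ, 1 ≤ q ∧ ∀ j : ℕ, m ≤ j → a i (j + q) = a i j)
    (hnz : ∀ i < p, ∀ J : ℕ, ∃ j, J ≤ j ∧ a i j ≠ 0) :
    ∃ β : ℕ → ℝ, (∀ i < p, 1 < β i) ∧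
      ∀ i < p,
        (∑' j : ℕ, (a i j : ℝ) /
          ∏ m ∈ Finset.range (j + 1), β ((((i : ℤ) - 1 - m) % (p : ℤ)).toNat)) = 1 := by
  have : NeZero p := ⟨by omega⟩
  have hbdd : ∀ i : ZMod p, ∃ B, ∀ j, a i.val j ≤ B := fun i => by
    obtain ⟨m, q, hq, h⟩ := hup i.val (ZMod.val_lt i)
    exact exists_le_of_ultimately_periodic hq h
  choose B hB using hbdd
  obtain ⟨b, hb, hsum⟩ := exists_cyclic_expansion_eq_one (p := p)
    (a := fun i j => (a i.val j : ℝ)) (B := ((∑ i, B i + 1 : ℕ) : ℝ))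
    (fun i j => Nat.cast_nonneg _) (by exact_mod_cast Nat.le_add_left 1 _)
    (fun i j => by
      have : B i ≤ ∑ i, B i := single_le_sum (f := B) (fun _ _ => Nat.zero_le _) (mem_univ i)
      exact_mod_cast (hB i j).trans (this.trans (Nat.le_succ _)))
    (fun i => by exact_mod_cast ha1 i.val (ZMod.val_lt i))
    (fun i => by
      obtain ⟨j, hj, hne⟩ := hnz i.val (ZMod.val_lt i) 1
      refine ⟨j - 1, ?_⟩
      rw [Nat.sub_add_cancel hj]
      exact_mod_cast Nat.pos_of_ne_zero hne)
  refine ⟨fun n => b n, fun i _ => hb _, fun i hi => ?_⟩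
  rw [← hsum (i : ZMod p)]
  refine tsum_congr fun j => ?_
  rw [ZMod.val_cast_of_lt hi, cyclicDenom]
  congr 1
  refine prod_congr rfl fun m _ => congrArg b ?_
  have h0 : 0 ≤ ((i : ℤ) - 1 - m) % (p : ℤ) := Int.emod_nonneg _ (by omega)
  rw [← Int.cast_natCast, Int.toNat_of_nonneg h0, ZMod.intCast_mod]
  push_cast
  rfl
end

section
/- Let p ≥ 1 and for each i ∈ {0,…,p−1} let 𝐚_i = a_{i,1}a_{i,2}⋯ be a sequence of nonnegative integers with a_{i,1} ≥ 1 and not eventually zero, with all digits bounded above by a nonnegative integer H (H being the maximum of all digits a_{i,j}). Set C = Hp + 1 and let L be the least integer ℓ ≥ 2 such that for every i ∈ {0,…,p−1} the prefix a_{i,1}⋯a_{i,ℓ} contains at least two nonzero digits. Then any real numbers β_0,…,β_{p−1}, all greater than 1, satisfying ∑_{j=1}^{∞} a_{i,j}/(β_{(i−1) mod p}⋯β_{(i−j) mod p}) = 1 for every i ∈ {0,…,p−1}, obey C^L/(C^L − 1) < β_i ≤ C for all i ∈ {0,…,p−1}. -/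
/-- If a `p`-periodic sequence `c` of reals greater than `1` satisfies
`∑ a j / (c 0 ⋯ c j) = 1` with digits `a j ≤ H`, then `c 0 ≤ H * p + 1`. -/
lemma le_of_hasSum_div_prod_eq_one {p H : ℕ} (hp : 1 ≤ p) {a : ℕ → ℕ} {c : ℕ → ℝ}
    (hc : ∀ m, 1 < c m) (hper : ∀ m, c (m + p) = c m) (ha : ∀ j, a j ≤ H)
    (hsum : HasSum (fun j => (a j : ℝ) / ∏ m ∈ Finset.range (j + 1), c m) 1) :
    c 0 ≤ H * p + 1 := by
  have hc0 : 0 < c 0 := by linarith [hc 0]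
  have hpos : ∀ n, 0 < ∏ m ∈ Finset.range n, c m :=
    fun n => Finset.prod_pos fun m _ => by linarith [hc m]
  have hge : ∀ n, c 0 ≤ ∏ m ∈ Finset.range (n + 1), c m := by
    intro n
    rw [Finset.prod_range_succ']
    refine le_mul_of_one_le_left hc0.le ?_
    simpa using Finset.prod_le_prod (s := Finset.range n) (f := fun _ => (1 : ℝ))
      (fun _ _ => zero_le_one) fun m _ => (hc (m + 1)).le
  set f : ℕ → ℝ := fun j => (∏ m ∈ Finset.range (j + 1), c m)⁻¹ with hf
  set Q := ∏ m ∈ Finset.range p, c m with hQ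
  have hQ0 : c 0 ≤ Q := by
    obtain ⟨q, rfl⟩ := Nat.exists_eq_add_of_le' hp
    exact hge q
  have hf0 : ∀ j, 0 ≤ f j := fun j => (inv_pos.2 (hpos _)).le
  have hfp : ∀ j, f (p + j) = f j * Q⁻¹ := by
    intro j
    simp only [hf]
    rw [add_assoc, Finset.prod_range_add, mul_inv, mul_comm]
    congr 2
    exact Finset.prod_congr rfl fun m _ => by rw [add_comm, hper]
  have hT : ∀ N, (∑ j ∈ Finset.range N, f j) * (c 0 - 1) ≤ p := by
    intro N
    have h1 : ∑ j ∈ Finset.range N, f j ≤ ∑ j ∈ Finset.range (p + N), f j :=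
      Finset.sum_le_sum_of_subset_of_nonneg (Finset.range_mono (by omega)) fun j _ _ => hf0 j
    rw [Finset.sum_range_add] at h1
    simp only [hfp, ← Finset.sum_mul] at h1
    have h2 : ∑ j ∈ Finset.range p, f j ≤ p * (c 0)⁻¹ := by
      have := Finset.sum_le_card_nsmul (Finset.range p) f (c 0)⁻¹
        fun j _ => inv_anti₀ hc0 (hge j)
      simpa using this
    have h3 : (∑ j ∈ Finset.range N, f j) * Q⁻¹ ≤ (∑ j ∈ Finset.range N, f j) * (c 0)⁻¹ :=
      mul_le_mul_of_nonneg_left (inv_anti₀ hc0 hQ0) (Finset.sum_nonneg fun j _ => hf0 j)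
    have h4 : ∑ j ∈ Finset.range N, f j ≤ (p + ∑ j ∈ Finset.range N, f j) / c 0 := by
      rw [div_eq_mul_inv, add_mul]
      linarith
    rw [le_div_iff₀ hc0] at h4
    linarith
  have hlim : 1 * (c 0 - 1) ≤ (H : ℝ) * p := by
    refine le_of_tendsto (hsum.tendsto_sum_nat.mul_const (c 0 - 1))
      (Filter.Eventually.of_forall fun N => ?_)
    calc (∑ j ∈ Finset.range N, (a j : ℝ) / ∏ m ∈ Finset.range (j + 1), c m) * (c 0 - 1)
        ≤ (H * ∑ j ∈ Finset.range N, f j) * (c 0 - 1) := by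
          refine mul_le_mul_of_nonneg_right ?_ (by linarith [hc 0])
          rw [Finset.mul_sum]
          refine Finset.sum_le_sum fun j _ => ?_
          rw [div_eq_mul_inv]
          exact mul_le_mul_of_nonneg_right (by exact_mod_cast ha j) (hf0 j)
      _ = H * ((∑ j ∈ Finset.range N, f j) * (c 0 - 1)) := mul_assoc _ _ _
      _ ≤ H * p := mul_le_mul_of_nonneg_left (hT N) (Nat.cast_nonneg H)
  linarith

/-- If `∑ a j / (c 0 ⋯ c j) = 1` with `c m ∈ (1, C]` and at least three nonzero digits, at
positions `0 < k < l`, then `1 + C⁻ᵏ < c 0`. -/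
lemma lt_of_hasSum_div_prod_eq_one {a : ℕ → ℕ} {c : ℕ → ℝ} {C : ℝ} {k l : ℕ}
    (hc : ∀ m, 1 < c m) (hcC : ∀ m, c m ≤ C) (hk : 0 < k) (hkl : k < l)
    (ha0 : 1 ≤ a 0) (hak : 1 ≤ a k) (hal : 1 ≤ a l)
    (hsum : HasSum (fun j => (a j : ℝ) / ∏ m ∈ Finset.range (j + 1), c m) 1) :
    1 + (C ^ k)⁻¹ < c 0 := by
  have hcpos : ∀ m, 0 < c m := fun m => by linarith [hc m]
  have hpos : ∀ n, 0 < ∏ m ∈ Finset.range n, c m :=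
    fun n => Finset.prod_pos fun m _ => hcpos m
  have hle := sum_le_hasSum {0, k, l} (fun j _ => div_nonneg (Nat.cast_nonneg _) (hpos _).le) hsum
  rw [Finset.sum_insert (by simp; omega), Finset.sum_insert (by simp; omega),
    Finset.sum_singleton] at hle
  have hterm : ∀ j, 1 ≤ a j → (∏ m ∈ Finset.range (j + 1), c m)⁻¹ ≤
      (a j : ℝ) / ∏ m ∈ Finset.range (j + 1), c m := by
    intro j hj
    rw [div_eq_mul_inv]
    exact le_mul_of_one_le_left (inv_pos.2 (hpos _)).le (by exact_mod_cast hj)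
  have h0 := hterm 0 ha0
  have h1 := hterm k hak
  have h2 := (inv_pos.2 (hpos (l + 1))).trans_le (hterm l hal)
  have hsplit := Finset.prod_range_succ' c k
  rw [hsplit, mul_inv] at h1
  rw [hsplit] at hle
  have h3 : (C ^ k)⁻¹ ≤ (∏ m ∈ Finset.range k, c (m + 1))⁻¹ := by
    refine inv_anti₀ (Finset.prod_pos fun m _ => hcpos _) ?_
    simpa using Finset.prod_le_prod (s := Finset.range k) (g := fun _ => C)
      (fun m _ => (hcpos (m + 1)).le) fun m _ => hcC (m + 1)
  have h4 := mul_le_mul_of_nonneg_right h3 (inv_pos.2 (hcpos 0)).le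
  simp only [zero_add, Finset.prod_range_one] at h0 hle
  have h5 : (1 + (C ^ k)⁻¹) / c 0 < 1 := by
    rw [div_eq_mul_inv, add_mul]
    linarith
  rwa [div_lt_one (hcpos 0)] at h5

theorem stmt14 (p : ℕ) (hp : 1 ≤ p)
    (a : ℕ → ℕ → ℕ)  -- `a i j` is the digit `a_{i,j+1}`
    (ha1 : ∀ i < p, 1 ≤ a i 0)
    (hnz : ∀ i < p, ∀ J : ℕ, ∃ j, J ≤ j ∧ a i j ≠ 0)
    (H : ℕ)
    (hH : ∀ i < p, ∀ j : ℕ, a i j ≤ H)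
    (hHmax : ∃ i < p, ∃ j : ℕ, a i j = H)
    (L : ℕ)
    (hL : 2 ≤ L ∧ ∀ i < p,
      2 ≤ ((Finset.range L).filter (fun j => a i j ≠ 0)).card)
    (hLmin : ∀ ℓ : ℕ,
      (2 ≤ ℓ ∧ ∀ i < p, 2 ≤ ((Finset.range ℓ).filter (fun j => a i j ≠ 0)).card) → L ≤ ℓ) :
    ∀ β : ℕ → ℝ, (∀ i < p, 1 < β i) →
      (∀ i < p,
        (∑' j : ℕ, (a i j : ℝ) /
          ∏ m ∈ Finset.range (j + 1), β ((((i : ℤ) - 1 - m) % (p : ℤ)).toNat)) = 1) →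
      ∀ i < p,
        ((H * p + 1 : ℕ) : ℝ) ^ L / (((H * p + 1 : ℕ) : ℝ) ^ L - 1) < β i ∧
        β i ≤ ((H * p + 1 : ℕ) : ℝ) := by
  intro β hβ hsum
  have hp0 : (0 : ℤ) < p := by exact_mod_cast hp
  set b : ℤ → ℝ := fun n => β ((n % (p : ℤ)).toNat) with hb
  have hb1 : ∀ n, 1 < b n := fun n =>
    hβ _ (by have := Int.emod_nonneg n hp0.ne'; have := Int.emod_lt_of_pos n hp0; omega)
  have hbper : ∀ n, b (n - p) = b n := fun n => by simp only [hb, Int.sub_emod_right]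
  have hrow : ∀ r < p, HasSum (fun j => (a r j : ℝ) /
      ∏ m ∈ Finset.range (j + 1), b ((r : ℤ) - 1 - m)) 1 := by
    intro r hr
    have hs : Summable (fun j => (a r j : ℝ) /
        ∏ m ∈ Finset.range (j + 1), b ((r : ℤ) - 1 - m)) := by
      by_contra hns
      exact zero_ne_one ((tsum_eq_zero_of_not_summable hns).symm.trans (hsum r hr))
    exact (hsum r hr) ▸ hs.hasSum
  have hfirst : ∀ i < p, ∃ r < p, b ((r : ℤ) - 1 - (0 : ℕ)) = β i := by
    intro i hi
    refine ⟨(i + 1) % p, Nat.mod_lt _ hp, ?_⟩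
    have : (((((i + 1) % p : ℕ) : ℤ) - 1 - (0 : ℕ)) % (p : ℤ)) = i := by
      push_cast
      rw [sub_zero, Int.emod_sub_emod, add_sub_cancel_right]
      exact Int.emod_eq_of_lt (by omega) (by omega)
    simp only [hb, this, Int.toNat_natCast]
  have hupper : ∀ i < p, β i ≤ (H : ℝ) * p + 1 := by
    intro i hi
    obtain ⟨r, hr, hri⟩ := hfirst i hi
    rw [← hri]
    exact le_of_hasSum_div_prod_eq_one (c := fun m : ℕ => b ((r : ℤ) - 1 - m)) hp
      (fun m => hb1 _) (fun m => by
        rw [← hbper ((r : ℤ) - 1 - m)]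
        push_cast
        ring_nf) (hH r hr) (hrow r hr)
  intro i hi
  push_cast
  refine ⟨?_, hupper i hi⟩
  obtain ⟨r, hr, hri⟩ := hfirst i hi
  obtain ⟨k, hk, hk0⟩ := Finset.exists_mem_ne (hL.2 r hr) 0
  rw [Finset.mem_filter, Finset.mem_range] at hk
  obtain ⟨l, hkl, hl⟩ := hnz r hr (k + 1)
  have hlt := lt_of_hasSum_div_prod_eq_one (c := fun m : ℕ => b ((r : ℤ) - 1 - m))
    (C := (H : ℝ) * p + 1) (fun m => hb1 _)
    (fun m => hupper _ (by
      have := Int.emod_nonneg ((r : ℤ) - 1 - m) hp0.ne'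
      have := Int.emod_lt_of_pos ((r : ℤ) - 1 - m) hp0
      omega))
    (Nat.pos_of_ne_zero hk0) hkl (ha1 r hr) (Nat.pos_of_ne_zero hk.2) (Nat.pos_of_ne_zero hl)
    (hrow r hr)
  simp only [hri] at hlt
  refine lt_of_le_of_lt ?_ hlt
  have hH1 : 1 ≤ H := (ha1 r hr).trans (hH r hr 0)
  have hC : (2 : ℝ) ≤ H * p + 1 := by
    have : 1 ≤ H * p := Nat.mul_pos hH1 hp
    have : (1 : ℝ) ≤ H * p := by exact_mod_cast this
    linarith
  generalize (H : ℝ) * p + 1 = C at hC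
  have hCk : 1 ≤ C ^ k := one_le_pow₀ (by linarith)
  have hCL : C * C ^ k ≤ C ^ L := by
    rw [← pow_succ']
    exact pow_le_pow_right₀ (by linarith) hk.1
  have hkL : C ^ k ≤ C ^ L - 1 := by nlinarith
  have hinv := inv_anti₀ (by linarith) hkL
  have hne : C ^ L - 1 ≠ 0 := by linarith
  have heq : C ^ L / (C ^ L - 1) = 1 + (C ^ L - 1)⁻¹ := by
    field_simp
    ring
  linarith
end

section
/- Let p ≥ 1 and for each i ∈ {0,…,p−1} let 𝐚_i = a_{i,1}a_{i,2}⋯ be a sequence of nonnegative integers taking only finitely many values (i.e., bounded) and lexicographically greater than 10^ω (that is, either a_{i,1} ≥ 2, or a_{i,1} = 1 and a_{i,j} ≥ 1 for some j ≥ 2). Then there exist real numbers β_0,…,β_{p−1}, all greater than 1, such that for every i ∈ {0,…,p−1}: ∑_{j=1}^{∞} a_{i,j}/(β_{(i−1) mod p}·β_{(i−2) mod p}⋯β_{(i−j) mod p}) = 1. -/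
open Filter Topology in
/-- A continuous family of nonnegative matrices, each positive along a full cycle, whose row sums
are less than one at the left endpoint and at least one at the right endpoint, has a positive
fixed vector for some parameter. -/
theorem exists_pos_fixed_mulVec {p : ℕ} [NeZero p] (M : ℝ → Matrix (ZMod p) (ZMod p) ℝ)
    {x₀ x₁ : ℝ} (hx : x₀ ≤ x₁)
    (hcont : ∀ i k, ContinuousOn (fun x => M x i k) (Set.Icc x₀ x₁))
    (hnonneg : ∀ x ∈ Set.Icc x₀ x₁, ∀ i k, 0 ≤ M x i k)
    (hpos : ∀ x ∈ Set.Icc x₀ x₁, ∀ i, 0 < M x i (i - 1))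
    (hlow : ∀ i, ∑ k, M x₀ i k < 1) (hhigh : ∀ i, 1 ≤ ∑ k, M x₁ i k) :
    ∃ x ∈ Set.Icc x₀ x₁, ∃ v : ZMod p → ℝ, (∀ i, 0 < v i) ∧ (M x).mulVec v = v := by
  have mulVec_nonneg : ∀ x ∈ Set.Icc x₀ x₁, ∀ w : ZMod p → ℝ, (∀ i, 0 ≤ w i) →
      ∀ i, 0 ≤ (M x).mulVec w i := fun x hx w hw i =>
    Finset.sum_nonneg fun k _ => mul_nonneg (hnonneg x hx i k) (hw k)
  have mulVec_pos : ∀ x ∈ Set.Icc x₀ x₁, ∀ w : ZMod p → ℝ, (∀ i, 0 ≤ w i) →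
      ∀ i, 0 < w (i - 1) → 0 < (M x).mulVec w i := fun x hx w hw i hi =>
    Finset.sum_pos' (fun k _ => mul_nonneg (hnonneg x hx i k) (hw k))
      ⟨i - 1, Finset.mem_univ _, mul_pos (hpos x hx i) hi⟩
  have cycle : ∀ (P : ZMod p → Prop) (i : ZMod p), P i → (∀ j, P (j - 1) → P j) → ∀ j, P j := by
    intro P i hi hP j
    have key : ∀ n : ℕ, P (i + n) := by
      intro n
      induction n with
      | zero => simpa using hi
      | succ n ih =>
        apply hP
        have : i + ((n + 1 : ℕ) : ZMod p) - 1 = i + n := by push_cast; ring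
        rwa [this]
    have := key (j - i).val
    rwa [ZMod.natCast_zmod_val, add_sub_cancel] at this
  let K : Set (ℝ × (ZMod p → ℝ)) := Set.Icc x₀ x₁ ×ˢ stdSimplex ℝ (ZMod p)
  have hK : IsCompact K := isCompact_Icc.prod (isCompact_stdSimplex ℝ (ZMod p))
  have hcontK : ∀ i, ContinuousOn
      (fun q : ℝ × (ZMod p → ℝ) => (M q.1).mulVec q.2 i - q.2 i) K := by
    intro i
    have : ∀ k, ContinuousOn (fun q : ℝ × (ZMod p → ℝ) => M q.1 i k) K := fun k =>
      (hcont i k).comp continuousOn_fst fun q hq => hq.1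
    simp only [Matrix.mulVec, dotProduct]
    exact (continuousOn_finsetSum _ fun k _ => (this k).mul
      ((continuous_apply k).comp continuous_snd).continuousOn).sub
      ((continuous_apply i).comp continuous_snd).continuousOn
  let S : Set (ℝ × (ZMod p → ℝ)) := K ∩ ⋂ i, K ∩ {q | 0 ≤ (M q.1).mulVec q.2 i - q.2 i}
  have hSmem : ∀ q, q ∈ S ↔ q ∈ K ∧ ∀ i, q.2 i ≤ (M q.1).mulVec q.2 i := by
    intro q
    simp only [S, Set.mem_inter_iff, Set.mem_iInter, Set.mem_ofPred_eq, sub_nonneg]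
    exact ⟨fun h => ⟨h.1, fun i => (h.2 i).2⟩, fun h => ⟨h.1, fun i => ⟨h.1, h.2 i⟩⟩⟩
  have hScompact : IsCompact S := by
    refine hK.inter_right (isClosed_iInter fun i => ?_)
    exact (hcontK i).preimage_isClosed_of_isClosed hK.isClosed isClosed_Ici
  have normalize : ∀ x ∈ Set.Icc x₀ x₁, ∀ u : ZMod p → ℝ, (∀ i, 0 ≤ u i) → (∃ i, 0 < u i) →
      (∀ i, u i ≤ (M x).mulVec u i) → ∃ v, (x, v) ∈ S := by
    intro x hx u hu ⟨i, hi⟩ hle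
    have hs : 0 < ∑ k, u k := Finset.sum_pos' (fun k _ => hu k) ⟨i, Finset.mem_univ _, hi⟩
    refine ⟨(∑ k, u k)⁻¹ • u, (hSmem _).2 ⟨⟨hx, fun k => ?_, ?_⟩, fun k => ?_⟩⟩
    · exact mul_nonneg (inv_nonneg.2 hs.le) (hu k)
    · simp only [Pi.smul_apply, smul_eq_mul, ← Finset.mul_sum]
      exact inv_mul_cancel₀ hs.ne'
    · simp only [Matrix.mulVec_smul, Pi.smul_apply, smul_eq_mul]
      exact mul_le_mul_of_nonneg_left (hle k) (inv_nonneg.2 hs.le)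
  have hSne : S.Nonempty := by
    obtain ⟨v, hv⟩ := normalize x₁ ⟨hx, le_rfl⟩ (fun _ => 1) (fun _ => zero_le_one)
      ⟨0, zero_lt_one⟩ (fun i => by simpa [Matrix.mulVec, dotProduct] using hhigh i)
    exact ⟨_, hv⟩
  obtain ⟨⟨x, v⟩, hq, hmin⟩ := hScompact.exists_isMinOn hSne continuousOn_fst
  obtain ⟨⟨hxI, hv0, hv1⟩, hle⟩ := (hSmem _).1 hq
  dsimp only at hxI hv0 hv1 hle
  have hvne : ∃ i, 0 < v i := by
    by_contra! h
    have := Finset.sum_nonpos (s := Finset.univ) fun i _ => h i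
    linarith
  have hx₀ : x₀ < x := by
    refine lt_of_le_of_ne hxI.1 ?_
    rintro rfl
    obtain ⟨m, hm⟩ := Finite.exists_max v
    obtain ⟨i, hi⟩ := hvne
    have hvm : 0 < v m := hi.trans_le (hm i)
    have h1 : (M x₀).mulVec v m ≤ (∑ k, M x₀ m k) * v m := by
      rw [Finset.sum_mul]
      exact Finset.sum_le_sum fun k _ =>
        mul_le_mul_of_nonneg_left (hm k) (hnonneg _ hxI m k)
    have h2 := hle m
    nlinarith [hlow m]
  have hfix : (M x).mulVec v = v := by
    by_contra hne
    obtain ⟨i, hi⟩ : ∃ i, v i < (M x).mulVec v i := by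
      by_contra! h
      exact hne (funext fun i => le_antisymm (h i) (hle i))
    have spread : ∀ n : ℕ, ∃ u : ZMod p → ℝ, (∀ j, 0 ≤ u j) ∧ (∃ j, 0 < u j) ∧
        (∀ j, u j ≤ (M x).mulVec u j) ∧
        ∀ m ≤ n, u (i + (m : ℕ)) < (M x).mulVec u (i + (m : ℕ)) := by
      intro n
      induction n with
      | zero => exact ⟨v, hv0, hvne, hle, fun m hm => by simpa [Nat.le_zero.1 hm] using hi⟩
      | succ n ih =>
        obtain ⟨u, hu0, ⟨k, hk⟩, hule, hult⟩ := ih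
        set w : ZMod p → ℝ := (M x).mulVec u - u with hw
        have hw0 : ∀ j, 0 ≤ w j := fun j => sub_nonneg.2 (hule j)
        have hMu := mulVec_nonneg x hxI u hu0
        have hMw := mulVec_nonneg x hxI w hw0
        have hgap : ∀ j, (M x).mulVec (u + (M x).mulVec u) j - (u + (M x).mulVec u) j =
            w j + (M x).mulVec w j := by
          intro j
          simp only [hw, Matrix.mulVec_add, Matrix.mulVec_sub, Pi.add_apply, Pi.sub_apply]
          ring
        refine ⟨u + (M x).mulVec u, fun j => add_nonneg (hu0 j) (hMu j),
          ⟨k, add_pos_of_pos_of_nonneg hk (hMu k)⟩, fun j => ?_, fun m hm => ?_⟩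
        · rw [← sub_nonneg, hgap]
          exact add_nonneg (hw0 j) (hMw j)
        · rw [← sub_pos, hgap]
          rcases Nat.le_succ_iff.1 hm with hm | rfl
          · exact add_pos_of_pos_of_nonneg (sub_pos.2 (hult m hm)) (hMw _)
          · refine add_pos_of_nonneg_of_pos (hw0 _) (mulVec_pos x hxI w hw0 _ ?_)
            have : i + ((n + 1 : ℕ) : ZMod p) - 1 = i + n := by push_cast; ring
            rw [this]
            exact sub_pos.2 (hult n le_rfl)
    obtain ⟨u, hu0, hune, -, hult⟩ := spread p
    have hult : ∀ j, u j < (M x).mulVec u j := by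
      intro j
      have := hult (j - i).val (ZMod.val_lt _).le
      rwa [ZMod.natCast_zmod_val, add_sub_cancel] at this
    have hev : ∀ᶠ y in 𝓝[Set.Icc x₀ x₁] x, ∀ j, u j < (M y).mulVec u j := by
      refine eventually_all.2 fun j => ?_
      have hc : ContinuousOn (fun y => (M y).mulVec u j) (Set.Icc x₀ x₁) :=
        continuousOn_finsetSum _ fun k _ => (hcont j k).mul continuousOn_const
      exact (hc x hxI).eventually (lt_mem_nhds (hult j))
    have hsub : Set.Ioo x₀ x ⊆ Set.Icc x₀ x₁ := fun y hy => ⟨hy.1.le, hy.2.le.trans hxI.2⟩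
    have := right_nhdsWithin_Ioo_neBot hx₀
    obtain ⟨y, hy, hyI⟩ := ((hev.filter_mono (nhdsWithin_mono x hsub)).and
      self_mem_nhdsWithin).exists
    obtain ⟨v', hv'⟩ := normalize y (hsub hyI) u hu0 hune fun j => (hy j).le
    exact hyI.2.not_ge (hmin hv')
  refine ⟨x, hxI, v, ?_, hfix⟩
  obtain ⟨i, hi⟩ := hvne
  refine cycle _ i hi fun j hj => ?_
  have := mulVec_pos x hxI v hv0 j hj
  rwa [hfix] at this

/-- A sum weighted by digits lexicographically above `1, 0, 0, …` dominates two of its terms. -/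
theorem exists_add_le_tsum_of_lex {b : ℕ → ℕ}
    (hb : 2 ≤ b 0 ∨ (b 0 = 1 ∧ ∃ j, 1 ≤ j ∧ 1 ≤ b j)) :
    ∃ J, ∀ g : ℕ → ℝ, (∀ j, 0 ≤ g j) → Summable (fun j => (b j : ℝ) * g j) →
      g 0 + g J ≤ ∑' j, (b j : ℝ) * g j := by
  rcases hb with hb | ⟨hb, J, hJ, hbJ⟩
  · refine ⟨0, fun g hg hs => ?_⟩
    have h := hs.le_tsum 0 fun j _ => mul_nonneg (Nat.cast_nonneg _) (hg j)
    have : (2 : ℝ) ≤ b 0 := by exact_mod_cast hb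
    nlinarith [hg 0]
  · refine ⟨J, fun g hg hs => ?_⟩
    have h := hs.sum_le_tsum {0, J} fun j _ => mul_nonneg (Nat.cast_nonneg _) (hg j)
    rw [Finset.sum_pair (by omega), hb] at h
    have : (1 : ℝ) ≤ b J := by exact_mod_cast hbJ
    push_cast at h
    nlinarith [hg J]

open Filter Topology in
/-- Bounded digits give a positive solution of the cyclic system of power series equations
at some parameter in `(0, 1)`. -/
theorem exists_pos_solution_digit_system {p : ℕ} [NeZero p] (b : ZMod p → ℕ → ℕ) (H : ℕ)
    (hH : ∀ i j, b i j ≤ H)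
    (hlex : ∀ i, 2 ≤ b i 0 ∨ (b i 0 = 1 ∧ ∃ j, 1 ≤ j ∧ 1 ≤ b i j)) :
    ∃ x : ℝ, 0 < x ∧ ∃ v : ZMod p → ℝ, (∀ i, 0 < v i) ∧ ∀ i,
      Summable (fun j : ℕ => (b i j : ℝ) * (x ^ (j + 1) * v (i - 1 - j))) ∧
      ∑' j : ℕ, (b i j : ℝ) * (x ^ (j + 1) * v (i - 1 - j)) = v i := by
  choose J hJ using fun i => exists_add_le_tsum_of_lex (hlex i)
  let f : ZMod p → ZMod p → ℕ → ℝ → ℝ := fun i k j x =>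
    (b i j : ℝ) * (x ^ (j + 1) * if i - 1 - (j : ZMod p) = k then 1 else 0)
  let M : ℝ → Matrix (ZMod p) (ZMod p) ℝ := fun x => Matrix.of fun i k => ∑' j, f i k j x
  have hgeom : ∀ x : ℝ, 0 ≤ x → x < 1 → Summable (fun j : ℕ => (H : ℝ) * x ^ (j + 1)) := by
    intro x h0 h1
    simp only [pow_succ]
    exact ((summable_geometric_of_lt_one h0 h1).mul_right x).mul_left _
  have hbH : ∀ i j, (b i j : ℝ) ≤ H := fun i j => by exact_mod_cast hH i j
  have hf0 : ∀ i k j (x : ℝ), 0 ≤ x → 0 ≤ f i k j x := by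
    intro i k j x h0
    simp only [f]
    positivity
  have hfle : ∀ i k j (x y : ℝ), 0 ≤ x → x ≤ y → f i k j x ≤ H * y ^ (j + 1) := by
    intro i k j x y h0 hxy
    refine mul_le_mul (hbH i j) ?_ (by positivity) (by positivity)
    refine (mul_le_of_le_one_right (by positivity) (by split_ifs <;> norm_num)).trans ?_
    gcongr
  have hfs : ∀ i k (x : ℝ), 0 ≤ x → x < 1 → Summable (fun j => f i k j x) := fun i k x h0 h1 =>
    (hgeom x h0 h1).of_nonneg_of_le (fun j => hf0 i k j x h0) fun j => hfle i k j x x h0 le_rfl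
  have hsum : ∀ (x : ℝ), 0 ≤ x → x < 1 → ∀ (v : ZMod p → ℝ) i, HasSum
      (fun j : ℕ => (b i j : ℝ) * (x ^ (j + 1) * v (i - 1 - j))) ((M x).mulVec v i) := by
    intro x h0 h1 v i
    have h : HasSum (fun j => ∑ k, f i k j x * v k) (∑ k, (∑' j, f i k j x) * v k) :=
      hasSum_sum fun k _ => (hfs i k x h0 h1).hasSum.mul_right (v k)
    convert h using 2 with j
    · simp [f, mul_assoc]
    · rfl
  have hrow : ∀ (x : ℝ), 0 ≤ x → x < 1 → ∀ i, HasSum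
      (fun j : ℕ => (b i j : ℝ) * x ^ (j + 1)) (∑ k, M x i k) := by
    intro x h0 h1 i
    simpa [Matrix.mulVec, dotProduct] using hsum x h0 h1 (fun _ => 1) i
  obtain ⟨x₁, hx₁, hhalf, hone⟩ : ∃ x₁ : ℝ, (∀ i, 1 ≤ x₁ ^ (0 + 1) + x₁ ^ (J i + 1)) ∧
      1 / 2 < x₁ ∧ x₁ < 1 := by
    have hev : ∀ᶠ x in 𝓝[<] (1 : ℝ), ∀ i, 1 ≤ x ^ (0 + 1) + x ^ (J i + 1) := by
      refine eventually_nhdsWithin_of_eventually_nhds (eventually_all.2 fun i => ?_)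
      have hc : Continuous fun x : ℝ => x ^ (0 + 1) + x ^ (J i + 1) := by fun_prop
      exact (hc.continuousAt.eventually (lt_mem_nhds (by norm_num : (1 : ℝ) < _))).mono
        fun x hx => hx.le
    obtain ⟨x, hx, hxI⟩ := (hev.and
      (Ioo_mem_nhdsLT (by norm_num : (1 / 2 : ℝ) < 1))).exists
    exact ⟨x, hx, hxI⟩
  have hH0 : (0 : ℝ) ≤ H := Nat.cast_nonneg H
  let x₀ : ℝ := 1 / (H + 2)
  have hx₀ : 0 < x₀ := by positivity
  have hx₀half : x₀ ≤ 1 / 2 := one_div_le_one_div_of_le (by norm_num) (by linarith)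
  have hI : ∀ x ∈ Set.Icc x₀ x₁, 0 < x ∧ x < 1 := fun x hx =>
    ⟨hx₀.trans_le hx.1, hx.2.trans_lt hone⟩
  obtain ⟨x, hx, v, hv, hfix⟩ := exists_pos_fixed_mulVec M (hx₀half.trans hhalf.le)
    (fun i k => continuousOn_tsum (u := fun j => H * x₁ ^ (j + 1))
      (fun j => by simp only [f]; fun_prop) (hgeom x₁ (by linarith) hone)
      fun j x hx => by
        rw [Real.norm_of_nonneg (hf0 i k j x (hI x hx).1.le)]
        exact hfle i k j x x₁ (hI x hx).1.le hx.2)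
    (fun x hx i k => tsum_nonneg fun j => hf0 i k j x (hI x hx).1.le)
    (fun x hx i => by
      refine (hfs i (i - 1) x (hI x hx).1.le (hI x hx).2).tsum_pos
        (fun j => hf0 i _ j x (hI x hx).1.le) 0 ?_
      have hb : 0 < b i 0 := by have := hlex i; omega
      have := (hI x hx).1
      simp only [f, Nat.cast_zero, sub_zero, if_true]
      positivity)
    (fun i => by
      have h1 : x₀ < 1 := by linarith
      have hg : HasSum (fun j : ℕ => (H : ℝ) * x₀ ^ (j + 1)) (H * ((1 - x₀)⁻¹ * x₀)) := by
        simp only [pow_succ]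
        exact ((hasSum_geometric_of_lt_one hx₀.le h1).mul_right x₀).mul_left _
      refine (hasSum_le (fun j => ?_) (hrow x₀ hx₀.le h1 i) hg).trans_lt ?_
      · exact mul_le_mul_of_nonneg_right (hbH i j) (by positivity)
      · have h2 : (1 - x₀)⁻¹ * x₀ = 1 / (H + 1) := by
          have : 1 - x₀ = (H + 1) / (H + 2) := by simp only [x₀]; field_simp; ring
          rw [this]
          simp only [x₀]
          field_simp
        rw [h2, mul_one_div, div_lt_one (by positivity)]
        linarith)
    (fun i => by
      have h := hrow x₁ (by linarith) hone i
      rw [← h.tsum_eq]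
      exact (hx₁ i).trans (hJ i (fun j => x₁ ^ (j + 1)) (fun j => by positivity) h.summable))
  refine ⟨x, (hI x hx).1, v, hv, fun i => ?_⟩
  have h := hsum x (hI x hx).1.le (hI x hx).2 v i
  rw [hfix] at h
  exact ⟨h.summable, h.tsum_eq⟩

theorem stmt15 (p : ℕ) (hp : 1 ≤ p)
    (a : ℕ → ℕ → ℕ)  -- `a i j` is the digit `a_{i,j+1}`
    (hbdd : ∀ i < p, ∃ H : ℕ, ∀ j : ℕ, a i j ≤ H)
    (hlex : ∀ i < p, 2 ≤ a i 0 ∨ (a i 0 = 1 ∧ ∃ j, 1 ≤ j ∧ 1 ≤ a i j)) :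
    ∃ β : ℕ → ℝ, (∀ i < p, 1 < β i) ∧
      ∀ i < p,
        (∑' j : ℕ, (a i j : ℝ) /
          ∏ m ∈ Finset.range (j + 1), β ((((i : ℤ) - 1 - m) % (p : ℤ)).toNat)) = 1 := by
  have : NeZero p := ⟨by omega⟩
  choose! H hH using hbdd
  obtain ⟨x, hx, v, hv, hsol⟩ := exists_pos_solution_digit_system
    (fun i : ZMod p => a i.val) (∑ i ∈ Finset.range p, H i)
    (fun i j => (hH _ (ZMod.val_lt i) j).trans
      (Finset.single_le_sum_of_canonicallyOrdered (Finset.mem_range.2 (ZMod.val_lt i))))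
    (fun i => hlex _ (ZMod.val_lt i))
  refine ⟨fun k => v ((k : ZMod p) + 1) / (x * v k), fun i _ => ?_, fun i hi => ?_⟩
  · rw [one_lt_div (mul_pos hx (hv _))]
    obtain ⟨hs, ht⟩ := hsol ((i : ZMod p) + 1)
    obtain ⟨J, hJ⟩ := exists_add_le_tsum_of_lex (hlex _ (ZMod.val_lt ((i : ZMod p) + 1)))
    have h := hJ _ (fun j => (mul_pos (pow_pos hx _) (hv _)).le) hs
    rw [ht] at h
    have h2 : 0 < x ^ (J + 1) * v ((i : ZMod p) + 1 - 1 - J) := mul_pos (pow_pos hx _) (hv _)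
    simp only [zero_add, pow_one, add_sub_cancel_right, Nat.cast_zero, sub_zero] at h h2
    linarith
  · have hcast : ∀ m : ℕ, (((((i : ℤ) - 1 - m) % (p : ℤ)).toNat : ℕ) : ZMod p) =
        (i : ZMod p) - 1 - m := by
      intro m
      rw [← Int.cast_natCast, Int.toNat_of_nonneg (Int.emod_nonneg _ (by omega)),
        ZMod.intCast_mod]
      push_cast
      rfl
    have hprod : ∀ n : ℕ, ∏ m ∈ Finset.range n,
        v ((((((i : ℤ) - 1 - m) % (p : ℤ)).toNat : ℕ) : ZMod p) + 1) /
          (x * v (((((i : ℤ) - 1 - m) % (p : ℤ)).toNat : ℕ) : ZMod p)) =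
        v i / (x ^ n * v ((i : ZMod p) - n)) := by
      intro n
      induction n with
      | zero => simp [(hv _).ne']
      | succ n ih =>
        rw [Finset.prod_range_succ, ih, hcast]
        have h1 : (i : ZMod p) - 1 - n + 1 = i - n := by ring
        have h2 : (i : ZMod p) - ((n + 1 : ℕ) : ZMod p) = i - 1 - n := by push_cast; ring
        rw [h1, h2]
        have := (hv ((i : ZMod p) - n)).ne'
        have := (hv ((i : ZMod p) - 1 - n)).ne'
        field_simp
        ring
    simp only [hprod]
    have ht := (hsol i).2
    rw [ZMod.val_cast_of_lt hi] at ht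
    calc _ = ∑' j : ℕ, (a i j : ℝ) * (x ^ (j + 1) * v ((i : ZMod p) - 1 - j)) / v i := by
          refine tsum_congr fun j => ?_
          have h2 : (i : ZMod p) - ((j + 1 : ℕ) : ZMod p) = i - 1 - j := by push_cast; ring
          rw [h2, div_div_eq_mul_div]
      _ = 1 := by rw [tsum_div_const, ht, div_self (hv _).ne']
end

section
/- Let p ≥ 1 and for each i ∈ {0,…,p−1} let 𝐚_i = a_{i,1}a_{i,2}⋯ be a sequence of nonnegative integers lexicographically greater than 10^ω. Assume that for every i ∈ {0,…,p−1}: if 𝐚_i is eventually zero then a_{i,j+1}a_{i,j+2}⋯ <_lex 𝐚_{(i−j) mod p} for all j ≥ 1, and if 𝐚_i is not eventually zero then a_{i,j+1}a_{i,j+2}⋯ ≤_lex 𝐚_{(i−j) mod p} for all j ≥ 1. Then there exists an alternate base B = (β_{p−1},…,β_0) of length p such that for every i ∈ {0,…,p−1}: if 𝐚_i is eventually zero then 𝐚_i is the greedy S^i(B)-expansion of 1, and if 𝐚_i is not eventually zero then 𝐚_i is the quasi-greedy S^i(B)-expansion of 1. Moreover: (1) if 𝐚_0,…,𝐚_{p−1}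 are all ultimately periodic, then B is the unique alternate base of length p with this property; (2) if a_{i,1} ≥ 2 for all i ∈ {0,…,p−1}, then B is the unique alternate base of length p with this property. -/
/-- `valS B n a = val_{S^n(B)}(0 · a)`, where `a j` is the `(j+1)`-st digit. -/
noncomputable def valS (B : ℤ → ℝ) (n : ℤ) (a : ℕ → ℕ) : ℝ :=
  ∑' j : ℕ, (a j : ℝ) / ∏ i ∈ Finset.range (j + 1), B (n - 1 - i)

/-- Strict lexicographic order on one-sided digit sequences. -/
def lexLt (x y : ℕ → ℕ) : Prop := ∃ j, (∀ i < j, x i = y i) ∧ x j < y j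

def lexLe (x y : ℕ → ℕ) : Prop := x = y ∨ lexLt x y

/-- The sequence ends in a tail of zeros. -/
def EvZero (x : ℕ → ℕ) : Prop := ∃ N, ∀ j ≥ N, x j = 0

/-- `t` is the greedy `S^n(B)`-expansion of `1`: it is lexicographically greatest among
sequences of nonnegative integers with value `1`. -/
def IsGreedyOne (B : ℤ → ℝ) (n : ℤ) (t : ℕ → ℕ) : Prop :=
  valS B n t = 1 ∧ ∀ b : ℕ → ℕ, valS B n b = 1 → lexLe b t

/-- `d` is the quasi-greedy `S^n(B)`-expansion of `1`: it is lexicographically greatest among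
sequences of nonnegative integers not ending in a tail of zeros with value `1`. -/
def IsQuasiGreedyOne (B : ℤ → ℝ) (n : ℤ) (d : ℕ → ℕ) : Prop :=
  ¬ EvZero d ∧ valS B n d = 1 ∧
    ∀ b : ℕ → ℕ, ¬ EvZero b → valS B n b = 1 → lexLe b d

/-- The sequence `1 0 0 0 ⋯`. -/
def tenOmega : ℕ → ℕ := fun j => if j = 0 then 1 else 0

/-- Ultimately periodic sequence. -/
def UltPer (x : ℕ → ℕ) : Prop := ∃ m q : ℕ, 1 ≤ q ∧ ∀ j : ℕ, m ≤ j → x (j + q) = x j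

open Finset Filter Topology

/-- The product `β_{n-1} β_{n-2} ⋯ β_{n-m}`. -/
noncomputable def bprod (B : ℤ → ℝ) (n : ℤ) (m : ℕ) : ℝ := ∏ i ∈ range m, B (n - 1 - i)

/-- The series defining `valS B n b` converges. -/
def ValSummable (B : ℤ → ℝ) (n : ℤ) (b : ℕ → ℕ) : Prop :=
  Summable fun j : ℕ => (b j : ℝ) / bprod B n (j + 1)

/-- The sequence with its first `m` digits removed. -/
def tailSeq (m : ℕ) (b : ℕ → ℕ) : ℕ → ℕ := fun j => b (j + m)

lemma valS_eq (B : ℤ → ℝ) (n : ℤ) (b : ℕ → ℕ) :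
    valS B n b = ∑' j : ℕ, (b j : ℝ) / bprod B n (j + 1) := rfl

lemma bprod_pos {B : ℤ → ℝ} (hB : ∀ n, 0 < B n) (n : ℤ) (m : ℕ) : 0 < bprod B n m :=
  prod_pos fun _ _ => hB _

lemma bprod_add (B : ℤ → ℝ) (n : ℤ) (k m : ℕ) :
    bprod B n (k + m) = bprod B n k * bprod B (n - k) m := by
  unfold bprod
  rw [prod_range_add]
  congr 1
  refine prod_congr rfl fun i _ => ?_
  congr 1
  push_cast
  ring

lemma bprod_succ (B : ℤ → ℝ) (n : ℤ) (m : ℕ) :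
    bprod B n (m + 1) = bprod B n m * B (n - 1 - m) := prod_range_succ _ _

lemma bprod_one (B : ℤ → ℝ) (n : ℤ) : bprod B n 1 = B (n - 1) := by
  simp [bprod]

lemma pow_le_bprod {B : ℤ → ℝ} {μ : ℝ} (hμ : 0 ≤ μ) (hB : ∀ n, μ ≤ B n) (n : ℤ) (m : ℕ) :
    μ ^ m ≤ bprod B n m := by
  have := prod_le_prod (s := range m) (f := fun _ => μ) (g := fun i : ℕ => B (n - 1 - i))
    (fun _ _ => hμ) (fun _ _ => hB _)
  simpa [bprod] using this

lemma bprod_add_period {B : ℤ → ℝ} {p : ℕ} (hper : ∀ n, B (n + p) = B n) (n : ℤ) (m : ℕ) :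
    bprod B (n + p) m = bprod B n m := by
  refine prod_congr rfl fun i _ => ?_
  rw [← hper (n - 1 - i)]
  congr 1
  ring

lemma digit_div_nonneg {B : ℤ → ℝ} (hB : ∀ n, 0 < B n) (n : ℤ) (b : ℕ → ℕ) (j : ℕ) :
    0 ≤ (b j : ℝ) / bprod B n (j + 1) :=
  div_nonneg (Nat.cast_nonneg _) (bprod_pos hB _ _).le

lemma valS_nonneg {B : ℤ → ℝ} (hB : ∀ n, 0 < B n) (n : ℤ) (b : ℕ → ℕ) : 0 ≤ valS B n b :=
  tsum_nonneg fun j => digit_div_nonneg hB n b j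

lemma valSummable_of_valS_eq_one {B : ℤ → ℝ} {n : ℤ} {b : ℕ → ℕ} (h : valS B n b = 1) :
    ValSummable B n b := by
  by_contra hns
  rw [valS_eq, tsum_eq_zero_of_not_summable hns] at h
  exact zero_ne_one h

lemma summable_bounded {B : ℤ → ℝ} {μ u : ℝ} (hu : 0 < u) (huμ : u < μ) (hB : ∀ n, μ ≤ B n)
    {b : ℕ → ℕ} {C : ℕ} (hC : ∀ j, b j ≤ C) (n : ℤ) :
    Summable fun j : ℕ => (b j : ℝ) / bprod B n (j + 1) * u ^ (j + 1) := by
  have hμ : 0 < μ := hu.trans huμ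
  have hpos : ∀ n, 0 < B n := fun n => hμ.trans_le (hB n)
  have hgeo : Summable fun j : ℕ => (C : ℝ) * ((u / μ) * (u / μ) ^ j) :=
    ((summable_geometric_of_lt_one (by positivity) ((div_lt_one hμ).2 huμ)).mul_left _).mul_left _
  refine Summable.of_nonneg_of_le
    (fun j => mul_nonneg (digit_div_nonneg hpos n b j) (by positivity)) (fun j => ?_) hgeo
  rw [← pow_succ', div_pow, div_mul_eq_mul_div, mul_div_assoc]
  have h1 : (b j : ℝ) ≤ C := by exact_mod_cast hC j
  have h2 := pow_le_bprod hμ.le hB n (j + 1)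
  have h3 := bprod_pos hpos n (j + 1)
  gcongr

lemma valSummable_of_bounded {B : ℤ → ℝ} {μ : ℝ} (hμ : 1 < μ) (hB : ∀ n, μ ≤ B n)
    {b : ℕ → ℕ} {C : ℕ} (hC : ∀ j, b j ≤ C) (n : ℤ) : ValSummable B n b := by
  simpa [ValSummable] using summable_bounded one_pos hμ hB hC n

lemma digit_div_tail (B : ℤ → ℝ) (n : ℤ) (b : ℕ → ℕ) (m j : ℕ) :
    (b (j + m) : ℝ) / bprod B n (j + m + 1) =
      ((tailSeq m b j : ℝ) / bprod B (n - m) (j + 1)) / bprod B n m := by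
  rw [show j + m + 1 = m + (j + 1) by ring, bprod_add, tailSeq, div_div, mul_comm]

lemma ValSummable.tail {B : ℤ → ℝ} (hB : ∀ n, 0 < B n) {n : ℤ} {b : ℕ → ℕ}
    (h : ValSummable B n b) (m : ℕ) : ValSummable B (n - m) (tailSeq m b) := by
  have h1 := (summable_nat_add_iff m).2 h
  simp only [digit_div_tail] at h1
  exact (summable_div_const_iff (bprod_pos hB n m).ne').1 h1

lemma valS_split {B : ℤ → ℝ} {n : ℤ} {b : ℕ → ℕ}
    (h : ValSummable B n b) (m : ℕ) :
    valS B n b = ∑ j ∈ range m, (b j : ℝ) / bprod B n (j + 1) +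
      valS B (n - m) (tailSeq m b) / bprod B n m := by
  rw [valS_eq, ← h.sum_add_tsum_nat_add m]
  simp only [digit_div_tail]
  rw [tsum_div_const, ← valS_eq]

/-- Comparison of the values of two sequences through their first difference. -/
lemma valS_first_diff {B : ℤ → ℝ} (hB : ∀ n, 0 < B n) {n : ℤ} {x y : ℕ → ℕ}
    (hx : ValSummable B n x) (hy : ValSummable B n y) {k : ℕ}
    (heq : ∀ i < k, x i = y i) (hlt : x k < y k) :
    (1 + valS B (n - (k + 1 : ℕ)) (tailSeq (k + 1) y) -
      valS B (n - (k + 1 : ℕ)) (tailSeq (k + 1) x)) / bprod B n (k + 1) ≤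
      valS B n y - valS B n x := by
  rw [valS_split hx (k + 1), valS_split hy (k + 1), sum_range_succ, sum_range_succ]
  have hpre : ∑ i ∈ range k, (x i : ℝ) / bprod B n (i + 1) =
      ∑ i ∈ range k, (y i : ℝ) / bprod B n (i + 1) :=
    sum_congr rfl fun i hi => by rw [heq i (mem_range.1 hi)]
  have hQ := bprod_pos hB n (k + 1)
  have h1 : (x k : ℝ) + 1 ≤ y k := by exact_mod_cast hlt
  have h2 : ((x k : ℝ) + 1) / bprod B n (k + 1) ≤ y k / bprod B n (k + 1) := by gcongr
  rw [add_div] at h2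
  rw [sub_div, add_div]
  linarith

lemma valS_pos_of_not_evZero {B : ℤ → ℝ} (hB : ∀ n, 0 < B n) {n : ℤ} {b : ℕ → ℕ}
    (h : ValSummable B n b) (hb : ¬ EvZero b) : 0 < valS B n b := by
  have hex : ∃ j, b j ≠ 0 := by
    by_contra hcon
    push Not at hcon
    exact hb ⟨0, fun j _ => hcon j⟩
  obtain ⟨j, hj⟩ := hex
  refine h.tsum_pos (fun j => digit_div_nonneg hB n b j) j ?_
  exact div_pos (by exact_mod_cast Nat.pos_of_ne_zero hj) (bprod_pos hB _ _)

lemma not_evZero_tail {b : ℕ → ℕ} (hb : ¬ EvZero b) (m : ℕ) : ¬ EvZero (tailSeq m b) := by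
  rintro ⟨N, hN⟩
  refine hb ⟨N + m, fun j hj => ?_⟩
  have := hN (j - m) (by omega)
  rwa [tailSeq, Nat.sub_add_cancel (by omega)] at this

lemma tailSeq_tailSeq (m k : ℕ) (b : ℕ → ℕ) : tailSeq k (tailSeq m b) = tailSeq (m + k) b := by
  funext j
  simp only [tailSeq]
  congr 1
  ring

lemma lexLe_or_lexLt (x y : ℕ → ℕ) : lexLe x y ∨ lexLt y x := by
  by_cases h : ∃ j, x j ≠ y j
  · classical
    have hmin : ∀ i < Nat.find h, x i = y i := fun i hi => not_not.1 (Nat.find_min h hi)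
    rcases lt_or_gt_of_ne (Nat.find_spec h) with hlt | hgt
    · exact Or.inl (Or.inr ⟨_, hmin, hlt⟩)
    · exact Or.inr ⟨_, fun i hi => (hmin i hi).symm, hgt⟩
  · push Not at h
    exact Or.inl (Or.inl (funext h))

lemma lexLe.head_le {x y : ℕ → ℕ} (h : lexLe x y) : x 0 ≤ y 0 := by
  rcases h with rfl | ⟨j, heq, hlt⟩
  · exact le_rfl
  · rcases Nat.eq_zero_or_pos j with rfl | hj
    · exact hlt.le
    · exact (heq 0 hj).le

section Parry

variable {B : ℤ → ℝ} {A : ℤ → ℕ → ℕ} {μ : ℝ} {C : ℕ}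

/-- Tails of the sequences in a system satisfying the lexicographic condition have value at
most `1`. -/
lemma valS_tail_le_one (hμ : 1 < μ) (hB : ∀ n, μ ≤ B n) (hC : ∀ n j, A n j ≤ C)
    (hval : ∀ n, valS B n (A n) = 1) (n : ℤ)
    (hlex : ∀ j : ℕ, lexLe (tailSeq j (A n)) (A (n - j))) (j : ℕ) :
    valS B (n - j) (tailSeq j (A n)) ≤ 1 := by
  have hpos : ∀ n, 0 < B n := fun n => by linarith [hB n]
  have hμ0 : 0 < μ := by linarith
  have hsum : ∀ n, ValSummable B n (A n) := fun n => valSummable_of_valS_eq_one (hval n)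
  set M : ℝ := ∑' j : ℕ, (C : ℝ) / μ ^ (j + 1) with hM
  have hgeo : Summable fun j : ℕ => (C : ℝ) / μ ^ (j + 1) := by
    have : Summable fun j : ℕ => (C : ℝ) * (μ⁻¹ * μ⁻¹ ^ j) :=
      ((summable_geometric_of_lt_one (by positivity) (inv_lt_one_of_one_lt₀ hμ)).mul_left
        _).mul_left _
    refine this.congr fun j => ?_
    rw [← pow_succ', inv_pow, div_eq_mul_inv]
  have hM0 : 0 ≤ M := tsum_nonneg fun j => by positivity
  have hbound : ∀ N : ℕ, ∀ j : ℕ, valS B (n - j) (tailSeq j (A n)) - 1 ≤ M / μ ^ N := by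
    intro N
    induction N with
    | zero =>
      intro j
      have : valS B (n - j) (tailSeq j (A n)) ≤ M := by
        refine ((hsum n).tail hpos j).tsum_le_tsum (fun i => ?_) hgeo
        have h1 : (tailSeq j (A n) i : ℝ) ≤ C := by exact_mod_cast hC _ _
        have h2 := pow_le_bprod hμ0.le hB (n - j) (i + 1)
        exact div_le_div₀ (Nat.cast_nonneg _) h1 (by positivity) h2
      simp only [pow_zero, div_one]
      linarith
    | succ N ih =>
      intro j
      have hnn : 0 ≤ M / μ ^ (N + 1) := by positivity
      rcases hlex j with heq | ⟨k, heq, hlt⟩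
      · rw [heq, hval, sub_self]
        exact hnn
      · have hd := valS_first_diff hpos ((hsum n).tail hpos j) (hsum (n - j)) heq hlt
        rw [hval, tailSeq_tailSeq, show n - (j : ℤ) - ((k + 1 : ℕ) : ℤ) =
          n - ((j + (k + 1) : ℕ) : ℤ) by push_cast; ring] at hd
        have hQ := bprod_pos hpos (n - j) (k + 1)
        rw [div_le_iff₀ hQ] at hd
        have htail := valS_nonneg hpos (n - ((j + (k + 1) : ℕ) : ℤ)) (tailSeq (k + 1) (A (n - j)))
        have hI := ih (j + (k + 1))
        have hQμ : μ ≤ bprod B (n - j) (k + 1) :=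
          (le_self_pow₀ hμ.le (by omega)).trans (pow_le_bprod hμ0.le hB (n - j) (k + 1))
        by_contra hcon
        push Not at hcon
        have h3 : M / μ ^ (N + 1) * μ = M / μ ^ N := by
          rw [pow_succ]
          field_simp
        have h4 : M / μ ^ (N + 1) * μ ≤ M / μ ^ (N + 1) * bprod B (n - j) (k + 1) :=
          mul_le_mul_of_nonneg_left hQμ hnn
        have h5 := mul_lt_mul_of_pos_right hcon hQ
        linarith
  have hlim : Tendsto (fun N : ℕ => M / μ ^ N) atTop (𝓝 0) :=
    tendsto_const_nhds.div_atTop (tendsto_pow_atTop_atTop_of_one_lt hμ)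
  have := ge_of_tendsto' hlim fun N => hbound N j
  linarith

lemma isQuasiGreedyOne_of_lex (hμ : 1 < μ) (hB : ∀ n, μ ≤ B n) (hC : ∀ n j, A n j ≤ C)
    (hval : ∀ n, valS B n (A n) = 1) (n : ℤ)
    (hlex : ∀ j : ℕ, lexLe (tailSeq j (A n)) (A (n - j))) (hne : ¬ EvZero (A n)) :
    IsQuasiGreedyOne B n (A n) := by
  have hpos : ∀ n, 0 < B n := fun n => by linarith [hB n]
  refine ⟨hne, hval n, fun b hb hb1 => (lexLe_or_lexLt _ _).resolve_right ?_⟩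
  rintro ⟨k, heq, hlt⟩
  have hbs := valSummable_of_valS_eq_one hb1
  have hd := valS_first_diff hpos (valSummable_of_valS_eq_one (hval n)) hbs heq hlt
  rw [hb1, hval, div_le_iff₀ (bprod_pos hpos _ _)] at hd
  have h1 := valS_tail_le_one hμ hB hC hval n hlex (k + 1)
  have h2 := valS_pos_of_not_evZero hpos (hbs.tail hpos (k + 1)) (not_evZero_tail hb (k + 1))
  linarith

lemma isGreedyOne_of_lex (hB : ∀ n, 0 < B n)
    (hval : ∀ n, valS B n (A n) = 1) (n : ℤ)
    (hlex : ∀ j : ℕ, 1 ≤ j → lexLt (tailSeq j (A n)) (A (n - j))) (hz : EvZero (A n)) :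
    IsGreedyOne B n (A n) := by
  have hsum : ∀ n, ValSummable B n (A n) := fun n => valSummable_of_valS_eq_one (hval n)
  obtain ⟨N, hN⟩ := hz
  have hlt1 : ∀ d j : ℕ, N ≤ j + d → 1 ≤ j → valS B (n - j) (tailSeq j (A n)) < 1 := by
    intro d
    induction d using Nat.strong_induction_on with
    | _ d ih =>
      intro j hjd hj
      by_cases hNj : N ≤ j
      · have : valS B (n - j) (tailSeq j (A n)) = 0 := by
          rw [valS_eq]
          simp only [tailSeq]
          simp [fun i => hN (i + j) (by omega)]
        rw [this]
        exact one_pos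
      · obtain ⟨k, heq, hlt⟩ := hlex j hj
        have hd := valS_first_diff hB ((hsum n).tail hB j) (hsum (n - j)) heq hlt
        rw [hval, tailSeq_tailSeq, show n - (j : ℤ) - ((k + 1 : ℕ) : ℤ) =
          n - ((j + (k + 1) : ℕ) : ℤ) by push_cast; ring] at hd
        have htail := valS_nonneg hB (n - ((j + (k + 1) : ℕ) : ℤ)) (tailSeq (k + 1) (A (n - j)))
        have hI := ih (d - (k + 1)) (by omega) (j + (k + 1)) (by omega) (by omega)
        have := div_pos (a := 1 + valS B (n - ((j + (k + 1) : ℕ) : ℤ))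
          (tailSeq (k + 1) (A (n - j))) - valS B (n - ((j + (k + 1) : ℕ) : ℤ))
          (tailSeq (j + (k + 1)) (A n))) (by linarith) (bprod_pos hB (n - j) (k + 1))
        linarith
  refine ⟨hval n, fun b hb1 => (lexLe_or_lexLt _ _).resolve_right ?_⟩
  rintro ⟨k, heq, hlt⟩
  have hd := valS_first_diff hB (hsum n) (valSummable_of_valS_eq_one hb1) heq hlt
  rw [hb1, hval, div_le_iff₀ (bprod_pos hB _ _)] at hd
  have h1 := hlt1 N (k + 1) (by omega) (by omega)
  have h2 := valS_nonneg hB (n - (k + 1 : ℕ)) (tailSeq (k + 1) b)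
  linarith

end Parry

section Gauge

variable {B B' : ℤ → ℝ} {p : ℕ}

lemma periodic_int_mul {α : Type*} {f : ℤ → α} (hf : ∀ n, f (n + p) = f n) (n k : ℤ) :
    f (n + k * p) = f n := by
  have h : Function.Periodic f (p : ℤ) := hf
  simpa using h.int_mul k n

lemma periodic_emod {α : Type*} {f : ℤ → α} (hf : ∀ n, f (n + p) = f n) (n : ℤ) :
    f (n % p) = f n := by
  conv_rhs => rw [← Int.emod_add_mul_ediv n p, mul_comm]
  exact (periodic_int_mul hf _ _).symm

lemma periodic_toNat {α : Type*} {f : ℤ → α} (hp : 1 ≤ p) (hf : ∀ n, f (n + p) = f n) (n : ℤ) :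
    (n % p).toNat < p ∧ f ((n % p).toNat : ℤ) = f n := by
  have h1 := Int.emod_nonneg n (b := p) (by omega)
  have h2 := Int.emod_lt_of_pos n (b := p) (by omega)
  refine ⟨by omega, ?_⟩
  rw [Int.toNat_of_nonneg h1, periodic_emod hf]

lemma exists_uniform_lower_bound (hp : 1 ≤ p) (hper : ∀ n, B (n + p) = B n)
    (hB : ∀ n, 1 < B n) : ∃ μ, 1 < μ ∧ ∀ n, μ ≤ B n := by
  obtain ⟨i, -, hi⟩ := (range p).exists_min_image (fun i : ℕ => B i) ⟨0, mem_range.2 hp⟩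
  refine ⟨B i, hB i, fun n => ?_⟩
  obtain ⟨h1, h2⟩ := periodic_toNat hp hper n
  rw [← h2]
  exact hi _ (mem_range.2 h1)

lemma bprod_gauge {r : ℤ → ℝ} (hr : ∀ n, B' n * r n = B n * r (n + 1)) (n : ℤ)
    (m : ℕ) : bprod B' n m * r (n - m) = bprod B n m * r n := by
  induction m with
  | zero => simp [bprod]
  | succ m ih =>
    have h := hr (n - 1 - m)
    rw [show n - 1 - (m : ℤ) + 1 = n - m by ring] at h
    rw [bprod_succ, bprod_succ, show n - ((m + 1 : ℕ) : ℤ) = n - 1 - m by push_cast; ring,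
      mul_assoc, h, mul_right_comm, mul_comm (B _), ← mul_assoc, ih]

lemma digit_div_gauge (hB : ∀ n, 0 < B n) (hB' : ∀ n, 0 < B' n) {r : ℤ → ℝ}
    (hr0 : ∀ n, 0 < r n) (hr : ∀ n, B' n * r n = B n * r (n + 1)) (n : ℤ) (d : ℝ) (j : ℕ) :
    d / bprod B' n (j + 1) = d / bprod B n (j + 1) * r (n - 1 - j) / r n := by
  have h := bprod_gauge hr n (j + 1)
  rw [show n - ((j + 1 : ℕ) : ℤ) = n - 1 - j by push_cast; ring] at h
  have h1 := bprod_pos hB n (j + 1)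
  have h2 := bprod_pos hB' n (j + 1)
  have h3 := hr0 n
  rw [div_mul_eq_mul_div, div_div, div_eq_div_iff h2.ne' (by positivity), ← h]
  ring

lemma exists_gauge {f : ℤ → ℝ} (hf : ∀ n, 0 < f n) :
    ∃ r : ℤ → ℝ, (∀ n, 0 < r n) ∧ ∀ n, r (n + 1) = f n * r n := by
  refine ⟨fun n => (∏ i ∈ range n.toNat, f i) / ∏ i ∈ range (-n).toNat, f (-1 - i),
    fun n => div_pos (prod_pos fun _ _ => hf _) (prod_pos fun _ _ => hf _), fun n => ?_⟩
  rcases le_or_gt 0 n with hn | hn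
  · lift n to ℕ using hn
    have h1 : (-(n : ℤ)).toNat = 0 := by omega
    have h2 : (-((n : ℤ) + 1)).toNat = 0 := by omega
    have h3 : ((n : ℤ) + 1).toNat = n + 1 := by omega
    simp only [h1, h2, h3, Int.toNat_natCast, prod_range_succ, prod_range_zero, div_one]
    ring
  · obtain ⟨m, rfl⟩ : ∃ m : ℕ, n = -1 - m := ⟨(-1 - n).toNat, by omega⟩
    have h1 : (-1 - (m : ℤ)).toNat = 0 := by omega
    have h2 : (-1 - (m : ℤ) + 1).toNat = 0 := by omega
    have h3 : (-(-1 - (m : ℤ))).toNat = m + 1 := by omega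
    have h4 : (-(-1 - (m : ℤ) + 1)).toNat = m := by omega
    simp only [h1, h2, h3, h4, prod_range_succ, prod_range_zero]
    have := hf (-1 - m)
    have h5 : 0 < ∏ i ∈ range m, f (-1 - (i : ℤ)) := prod_pos fun _ _ => hf _
    field_simp

end Gauge

section Uniqueness

variable {B B' : ℤ → ℝ} {p : ℕ} {A : ℤ → ℕ → ℕ}

/-- A function on `ℤ` that is at each point a weighted average of its previous values, with
positive weight on the immediate predecessor, and that is multiplied by `s ≥ 1` under translation
by `p`, is constant. -/
lemma const_of_weighted_average (hp : 1 ≤ p) {c : ℤ → ℕ → ℝ} {r : ℤ → ℝ} {s : ℝ}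
    (hc : ∀ n j, 0 ≤ c n j) (hc0 : ∀ n, 0 < c n 0) (hcs : ∀ n, HasSum (c n) 1)
    (hr0 : ∀ n, 0 < r n) (hr : ∀ n, HasSum (fun j : ℕ => c n j * r (n - 1 - j)) (r n))
    (hs : 1 ≤ s) (hrs : ∀ n, r (n + p) = s * r n) : ∃ R, ∀ n, r n = R := by
  obtain ⟨m, hm, hmax⟩ := (range p).exists_max_image (fun i : ℕ => r i) ⟨0, mem_range.2 hp⟩
  have hle : ∀ k : ℕ, ∀ n : ℤ, n < k → r n ≤ r m := by
    have hstep : ∀ N : ℤ, (∀ n < N, r n ≤ r m) → r N ≤ r m := by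
      intro N hN
      have h1 := (hcs N).mul_right (r m)
      rw [one_mul] at h1
      exact hasSum_le (fun j => mul_le_mul_of_nonneg_left (hN _ (by omega)) (hc N j)) (hr N) h1
    have hbase : ∀ d : ℕ, ∀ n : ℤ, -(d : ℤ) ≤ n → n < p → r n ≤ r m := by
      intro d
      induction d with
      | zero =>
        intro n h1 h2
        lift n to ℕ using by omega
        exact hmax n (mem_range.2 (by omega))
      | succ d ih =>
        intro n h1 h2
        by_cases h : -(d : ℤ) ≤ n
        · exact ih n h h2
        · have h3 := ih (n + p) (by omega) (by omega)
          rw [hrs] at h3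
          nlinarith [hr0 n]
    intro k
    induction k with
    | zero => exact fun n hn => hbase n.natAbs n (by omega) (by omega)
    | succ k ih =>
      intro n hn
      by_cases h : n < k
      · exact ih n h
      · obtain rfl : n = k := by push_cast at hn; omega
        exact hstep _ ih
  have hall : ∀ n, r n ≤ r m := fun n => hle (n.toNat + 1) n (by omega)
  have hs1 : s = 1 := by
    have h := hall (m + p)
    rw [hrs] at h
    have := hr0 m
    by_contra hne
    have : 1 < s := lt_of_le_of_ne hs (Ne.symm hne)
    nlinarith
  have hper : ∀ n, r (n + p) = r n := fun n => by rw [hrs, hs1, one_mul]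
  have hpred : ∀ n, r n = r m → r (n - 1) = r m := by
    intro n hn
    refine (hall _).antisymm (le_of_not_gt fun hlt => ?_)
    have h1 := (hcs n).mul_right (r m)
    rw [one_mul] at h1
    have hle1 : (fun j : ℕ => c n j * r (n - 1 - j)) ≤ fun j => c n j * r m := fun j =>
      mul_le_mul_of_nonneg_left (hall (n - 1 - j)) (hc n j)
    refine absurd (hasSum_lt (i := 0) hle1 ?_ (hr n) h1) hn.not_lt
    simpa using mul_lt_mul_of_pos_left hlt (hc0 n)
  have hdown : ∀ d : ℕ, r (m - d) = r m := by
    intro d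
    induction d with
    | zero => simp
    | succ d ih =>
      rw [← hpred _ ih]
      congr 1
      push_cast
      ring
  refine ⟨r m, fun n => ?_⟩
  rw [← periodic_int_mul hper n (-(n.natAbs : ℤ))]
  have h3 : (n.natAbs : ℤ) ≤ n.natAbs * p := by
    have : (1 : ℤ) ≤ p := by exact_mod_cast hp
    nlinarith [Int.natCast_nonneg n.natAbs]
  rw [← hdown (m - (n + -(n.natAbs : ℤ) * p)).toNat]
  congr 1
  rw [Int.toNat_of_nonneg (by rw [neg_mul]; omega)]
  ring

lemma eq_of_gauge (hp : 1 ≤ p) (hB : ∀ n, 0 < B n) (hB' : ∀ n, 0 < B' n)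
    (hA0 : ∀ n, 1 ≤ A n 0) (hv : ∀ n, valS B n (A n) = 1)
    (hv' : ∀ n, valS B' n (A n) = 1) {r : ℤ → ℝ} (hr0 : ∀ n, 0 < r n)
    (hr : ∀ n, B' n * r n = B n * r (n + 1)) {s : ℝ} (hs : 1 ≤ s)
    (hrs : ∀ n, r (n + p) = s * r n) : B' = B := by
  have hsum : ∀ {D : ℤ → ℝ}, (∀ n, valS D n (A n) = 1) → ∀ n,
      HasSum (fun j : ℕ => (A n j : ℝ) / bprod D n (j + 1)) 1 := by
    intro D hD n
    have h := (valSummable_of_valS_eq_one (hD n)).hasSum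
    rwa [← valS_eq, hD] at h
  obtain ⟨R, hR⟩ := const_of_weighted_average hp
    (c := fun n j => (A n j : ℝ) / bprod B n (j + 1)) (fun n j => digit_div_nonneg hB n _ j)
    (fun n => div_pos (by exact_mod_cast hA0 n) (bprod_pos hB _ _)) (hsum hv) hr0
    (fun n => by
      have h := (hsum hv' n).mul_right (r n)
      simp only [digit_div_gauge hB hB' hr0 hr, div_mul_cancel₀ _ (hr0 n).ne', one_mul] at h
      exact h) hs hrs
  funext n
  have h := hr n
  rw [hR (n + 1), ← hR n] at h
  exact mul_right_cancel₀ (hr0 n).ne' h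

/-- An alternate base is determined by the sequences whose value in its shifts is `1`. -/
lemma base_unique (hp : 1 ≤ p) (hB : ∀ n, 0 < B n) (hB' : ∀ n, 0 < B' n)
    (hper : ∀ n, B (n + p) = B n) (hper' : ∀ n, B' (n + p) = B' n)
    (hA0 : ∀ n, 1 ≤ A n 0) (hv : ∀ n, valS B n (A n) = 1)
    (hv' : ∀ n, valS B' n (A n) = 1) : B' = B := by
  obtain ⟨r, hr0, hr⟩ := exists_gauge (f := fun n => B' n / B n) fun n => div_pos (hB' n) (hB n)
  have hr1 : ∀ n, B' n * r n = B n * r (n + 1) := fun n => by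
    have := hB n
    rw [hr]
    field_simp
  have hstep : ∀ n, r (n + 1 + p) / r (n + 1) = r (n + p) / r n := fun n => by
    rw [add_right_comm, hr, hr, hper, hper', mul_div_mul_left _ _ (div_pos (hB' n) (hB n)).ne']
  have hrs : ∀ n, r (n + p) = r p / r 0 * r n := by
    have hconst : ∀ n, r (n + p) / r n = r p / r 0 := by
      intro n
      induction n using Int.induction_on with
      | zero => simp
      | succ n ih => rw [hstep, ih]
      | pred n ih =>
        have := hstep (-(n : ℤ) - 1)
        rw [sub_add_cancel, ih] at this
        exact this.symm
    intro n
    rw [← hconst n, div_mul_cancel₀ _ (hr0 n).ne']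
  rcases le_total 1 (r p / r 0) with h | h
  · exact eq_of_gauge hp hB hB' hA0 hv hv' hr0 hr1 h hrs
  · refine (eq_of_gauge hp hB' hB hA0 hv' hv (r := fun n => (r n)⁻¹)
      (fun n => inv_pos.2 (hr0 n)) (fun n => ?_) (s := (r p / r 0)⁻¹)
      ((one_le_inv₀ (div_pos (hr0 _) (hr0 _))).2 h) fun n => ?_).symm
    · have h1 := hr0 n
      have h2 := hr0 (n + 1)
      have h3 := hr1 n
      field_simp
      linarith
    · rw [hrs, mul_inv]

end Uniqueness

section Existence

variable {B : ℤ → ℝ} {p : ℕ} {A : ℤ → ℕ → ℕ} {C : ℕ}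

/-- The operator `g ↦ (∑_j c_{n,j} g_{n-1-j})_n`. -/
noncomputable def convOp (c : ℤ → ℕ → ℝ) (g : ℤ → ℝ) (n : ℤ) : ℝ :=
  ∑' j : ℕ, c n j * g (n - 1 - j)

/-- If nonnegative `p`-periodic weights have all sums at most `1`, some sum less than `1`, and
positive weight on the immediate predecessor, then there is a positive periodic function on which
the associated operator is strictly decreasing. -/
lemma exists_strict_gauge (hp : 1 ≤ p) {c : ℤ → ℕ → ℝ}
    (hc : ∀ n j, 0 ≤ c n j) (hc0 : ∀ n, 0 < c n 0) (hcs : ∀ n, Summable (c n))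
    (hcp : ∀ n, c (n + p) = c n)
    (hle : ∀ n, ∑' j, c n j ≤ 1) {i : ℤ} (hlt : ∑' j, c i j < 1) :
    ∃ g : ℤ → ℝ, (∀ n, 0 < g n) ∧ (∀ n, g (n + p) = g n) ∧
      ∀ n, (Summable fun j : ℕ => c n j * g (n - 1 - j)) ∧
        ∑' j : ℕ, c n j * g (n - 1 - j) < g n := by
  set G : ℕ → ℤ → ℝ := fun k => (convOp c)^[k] 1 with hG
  have hG0 : ∀ n, G 0 n = 1 := fun n => rfl
  have hGs : ∀ k n, G (k + 1) n = ∑' j : ℕ, c n j * G k (n - 1 - j) := fun k n => by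
    simp only [hG, Function.iterate_succ_apply']
    rfl
  have hbd : ∀ k n, 0 ≤ G k n ∧ G k n ≤ 1 := by
    intro k
    induction k with
    | zero => exact fun n => by rw [hG0]; exact ⟨zero_le_one, le_rfl⟩
    | succ k ih =>
      intro n
      rw [hGs]
      have h1 : ∀ j : ℕ, c n j * G k (n - 1 - j) ≤ c n j := fun j =>
        mul_le_of_le_one_right (hc n j) (ih _).2
      have h0 : ∀ j : ℕ, 0 ≤ c n j * G k (n - 1 - j) := fun j => mul_nonneg (hc n j) (ih _).1
      exact ⟨tsum_nonneg h0,
        ((Summable.of_nonneg_of_le h0 h1 (hcs n)).tsum_le_tsum h1 (hcs n)).trans (hle n)⟩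
  have hterm : ∀ k n, ∀ j : ℕ, c n j * G k (n - 1 - j) ≤ c n j := fun k n j =>
    mul_le_of_le_one_right (hc n j) (hbd _ _).2
  have hsum : ∀ k n, Summable fun j : ℕ => c n j * G k (n - 1 - j) := fun k n =>
    Summable.of_nonneg_of_le (fun j => mul_nonneg (hc n j) (hbd k _).1) (hterm k n) (hcs n)
  have hGp : ∀ k n, G k (n + p) = G k n := by
    intro k
    induction k with
    | zero => exact fun n => by rw [hG0, hG0]
    | succ k ih =>
      intro n
      rw [hGs, hGs, hcp]
      refine tsum_congr fun j => ?_
      rw [← ih (n - 1 - j)]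
      congr 2
      ring
  have hstrict : ∀ k m : ℕ, m ≤ k → G (k + 1) (i + m) < 1 := by
    intro k
    induction k with
    | zero =>
      intro m hm
      obtain rfl : m = 0 := by omega
      rw [hGs]
      simpa [hG0] using hlt
    | succ k ih =>
      intro m hm
      rw [hGs]
      rcases Nat.eq_zero_or_pos m with rfl | hmpos
      · simp only [Nat.cast_zero, add_zero]
        exact ((hsum _ _).tsum_le_tsum (hterm _ _) (hcs i)).trans_lt hlt
      · refine (Summable.tsum_lt_tsum (i := 0) (hterm (k + 1) (i + m)) ?_ (hsum _ _)
          (hcs _)).trans_le (hle _)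
        refine mul_lt_of_lt_one_right (hc0 _) ?_
        have h := ih (m - 1) (by omega)
        rwa [show i + ((m - 1 : ℕ) : ℤ) = i + m - 1 - ((0 : ℕ) : ℤ) by omega] at h
  have hlt1 : ∀ n, G p n < 1 := by
    intro n
    obtain ⟨q, rfl⟩ : ∃ q, p = q + 1 := ⟨p - 1, by omega⟩
    obtain ⟨h1, h2⟩ := periodic_toNat hp (f := fun n => G (q + 1) (i + n))
      (fun n => by rw [← add_assoc, hGp]) (n - i)
    have h3 := hstrict q _ (Nat.lt_succ_iff.1 h1)
    rw [h2, add_sub_cancel] at h3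
    exact h3
  refine ⟨fun n => ∑ k ∈ range p, G k n, fun n => ?_, fun n => by simp only [hGp], fun n => ?_⟩
  · refine lt_of_lt_of_le one_pos ?_
    rw [← hG0 n]
    exact single_le_sum (f := fun k => G k n) (fun k _ => (hbd k n).1) (mem_range.2 hp)
  · simp only [mul_sum]
    refine ⟨summable_sum fun k _ => hsum k n, ?_⟩
    rw [Summable.tsum_finsetSum fun k _ => hsum k n]
    simp only [← hGs]
    have h1 := sum_range_succ (fun k => G k n) p
    have h2 := sum_range_succ' (fun k => G k n) p
    rw [hG0] at h2
    linarith [hlt1 n]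

/-- Nonnegative power series with value less than `1` at `1` stay below `1` slightly beyond `1`,
uniformly over a periodic family. -/
lemma exists_scale (hp : 1 ≤ p) {c : ℤ → ℕ → ℝ} (hc : ∀ n j, 0 ≤ c n j)
    (hcp : ∀ n, c (n + p) = c n) {v : ℝ} (hv : 1 < v)
    (hcs : ∀ n, Summable fun j => c n j * v ^ (j + 1)) (hlt : ∀ n, ∑' j, c n j < 1) :
    ∃ u, 1 < u ∧ ∀ n, (Summable fun j => c n j * u ^ (j + 1)) ∧
      ∑' j, c n j * u ^ (j + 1) ≤ 1 := by
  have hIoo : ∀ᶠ u in 𝓝[>] (1 : ℝ), u ∈ Set.Ioo 1 v := Ioo_mem_nhdsGT hv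
  have hdom : ∀ n, ∀ u ∈ Set.Ioo 1 v, ∀ j, c n j * u ^ (j + 1) ≤ c n j * v ^ (j + 1) := by
    intro n u hu j
    have h0 := hc n j
    have h1 : 0 ≤ u := by linarith [hu.1]
    have h2 := hu.2.le
    gcongr
  have hnn : ∀ n, ∀ u ∈ Set.Ioo 1 v, ∀ j, 0 ≤ c n j * u ^ (j + 1) := by
    intro n u hu j
    have h1 : 0 < u := by linarith [hu.1]
    exact mul_nonneg (hc n j) (by positivity)
  have hev : ∀ n, ∀ᶠ u in 𝓝[>] (1 : ℝ), ∑' j, c n j * u ^ (j + 1) < 1 := by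
    intro n
    have ht : Tendsto (fun u : ℝ => ∑' j, c n j * u ^ (j + 1)) (𝓝[>] 1) (𝓝 (∑' j, c n j)) := by
      refine tendsto_tsum_of_dominated_convergence (hcs n) (fun j => ?_) ?_
      · have : Continuous fun u : ℝ => c n j * u ^ (j + 1) := by fun_prop
        have h := (this.tendsto 1).mono_left (nhdsWithin_le_nhds (s := Set.Ioi 1))
        simpa using h
      · filter_upwards [hIoo] with u hu j
        rw [Real.norm_of_nonneg (hnn n u hu j)]
        exact hdom n u hu j
    exact ht.eventually_lt_const (hlt n)
  have hfin : ∀ᶠ u in 𝓝[>] (1 : ℝ), ∀ i ∈ range p, ∑' j, c (i : ℕ) j * u ^ (j + 1) < 1 :=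
    (Filter.eventually_all_finset (range p)).2 fun i _ => hev i
  obtain ⟨u, hu, hu'⟩ := (hIoo.and hfin).exists
  refine ⟨u, hu.1, fun n =>
    ⟨Summable.of_nonneg_of_le (hnn n u hu) (hdom n u hu) (hcs n), ?_⟩⟩
  obtain ⟨h1, h2⟩ := periodic_toNat hp hcp n
  rw [← h2]
  exact (hu' _ (mem_range.2 h1)).le

/-- A periodic sequence of positive reals such that all the values of the sequences `A n` are at
most `1`. -/
structure IsSuper (p : ℕ) (A : ℤ → ℕ → ℕ) (B : ℤ → ℝ) : Prop where
  pos : ∀ n, 0 < B n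
  periodic : ∀ n, B (n + p) = B n
  partial_le : ∀ n N, ∑ j ∈ range N, (A n j : ℝ) / bprod B n (j + 1) ≤ 1

lemma IsSuper.summable (h : IsSuper p A B) (n : ℤ) : ValSummable B n (A n) :=
  summable_of_sum_range_le (fun j => digit_div_nonneg h.pos n _ j) (h.partial_le n)

lemma IsSuper.valS_le_one (h : IsSuper p A B) (n : ℤ) : valS B n (A n) ≤ 1 :=
  (h.summable n).tsum_le_of_sum_range_le (h.partial_le n)

lemma IsSuper.of_valS (hpos : ∀ n, 0 < B n) (hper : ∀ n, B (n + p) = B n)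
    (hs : ∀ n, ValSummable B n (A n)) (hv : ∀ n, valS B n (A n) ≤ 1) : IsSuper p A B :=
  ⟨hpos, hper, fun n _ =>
    ((hs n).sum_le_tsum _ fun j _ => digit_div_nonneg hpos n _ j).trans (hv n)⟩

lemma IsSuper.one_le (h : IsSuper p A B) (hA0 : ∀ n, 1 ≤ A n 0) (n : ℤ) : 1 ≤ B n := by
  have h1 := h.partial_le (n + 1) 1
  simp only [sum_range_one, zero_add, bprod_one, add_sub_cancel_right] at h1
  rw [div_le_one (h.pos n)] at h1
  exact le_trans (by exact_mod_cast hA0 (n + 1)) h1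

lemma IsSuper.one_lt (h : IsSuper p A B) (hten : ∀ n, lexLt tenOmega (A n)) (n : ℤ) :
    1 < B n := by
  obtain ⟨k, heq, hlt⟩ := hten (n + 1)
  have hk : 1 ≤ A (n + 1) k := by omega
  rcases Nat.eq_zero_or_pos k with rfl | hkpos
  · have h1 := h.partial_le (n + 1) 1
    simp only [sum_range_one, zero_add, bprod_one, add_sub_cancel_right] at h1
    rw [div_le_one (h.pos n)] at h1
    have h2 : 1 < A (n + 1) 0 := by simpa [tenOmega] using hlt
    exact lt_of_lt_of_le (by exact_mod_cast h2) h1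
  · have h1 := h.partial_le (n + 1) (k + 1)
    rw [sum_range_succ] at h1
    have h2 := single_le_sum (f := fun j => (A (n + 1) j : ℝ) / bprod B (n + 1) (j + 1))
      (fun j _ => digit_div_nonneg h.pos (n + 1) _ j) (mem_range.2 hkpos)
    have h3 : (0 : ℝ) < A (n + 1) k / bprod B (n + 1) (k + 1) :=
      div_pos (by exact_mod_cast hk) (bprod_pos h.pos _ _)
    have h4 : A (n + 1) 0 = 1 := by simpa [tenOmega] using (heq 0 hkpos).symm
    simp only [h4, zero_add, bprod_one, add_sub_cancel_right, Nat.cast_one] at h2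
    have h5 : 1 / B n < 1 := by linarith
    rwa [div_lt_one (h.pos n)] at h5

lemma IsSuper.of_const (hC : ∀ n j, A n j ≤ C) : IsSuper p A fun _ => (C : ℝ) + 1 := by
  have hC0 : (0 : ℝ) < C + 1 := by positivity
  refine ⟨fun _ => hC0, fun _ => rfl, fun n N => ?_⟩
  have hgeo : ∑ j ∈ range N, (C : ℝ) / (C + 1) ^ (j + 1) = 1 - 1 / (C + 1) ^ N := by
    induction N with
    | zero => simp
    | succ N ih =>
      rw [sum_range_succ, ih, pow_succ]
      field_simp
      ring
  have hle : ∑ j ∈ range N, (A n j : ℝ) / bprod (fun _ => (C : ℝ) + 1) n (j + 1) ≤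
      ∑ j ∈ range N, (C : ℝ) / (C + 1) ^ (j + 1) := by
    refine sum_le_sum fun j _ => ?_
    have h1 : (A n j : ℝ) ≤ C := by exact_mod_cast hC n j
    simp only [bprod, prod_const, card_range]
    gcongr
  have : (0 : ℝ) < 1 / (C + 1) ^ N := by positivity
  linarith

lemma exists_isSuper_prod_lt (hp : 1 ≤ p) (hC : ∀ n j, A n j ≤ C)
    (hten : ∀ n, lexLt tenOmega (A n)) (hA0 : ∀ n, 1 ≤ A n 0)
    (hAp : ∀ n, A (n + p) = A n) (h : IsSuper p A B) {i : ℤ} (hlt : valS B i (A i) < 1) :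
    ∃ B', IsSuper p A B' ∧ ∏ i ∈ range p, B' i < ∏ i ∈ range p, B i := by
  obtain ⟨g, hg0, hgp, hg⟩ := exists_strict_gauge hp
    (c := fun n j => (A n j : ℝ) / bprod B n (j + 1))
    (fun n j => digit_div_nonneg h.pos n _ j)
    (fun n => div_pos (by exact_mod_cast hA0 n) (bprod_pos h.pos _ _)) h.summable
    (fun n => by simp only [hAp, bprod_add_period h.periodic]) h.valS_le_one hlt
  set D : ℤ → ℝ := fun n => B n * g (n + 1) / g n with hD
  have hDpos : ∀ n, 0 < D n := fun n => div_pos (mul_pos (h.pos n) (hg0 _)) (hg0 n)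
  have hDg : ∀ n, D n * g n = B n * g (n + 1) := fun n => div_mul_cancel₀ _ (hg0 n).ne'
  have hDper : ∀ n, D (n + p) = D n := fun n => by
    simp only [hD]
    rw [h.periodic, hgp, add_right_comm, hgp]
  have hdig : ∀ n (j : ℕ), (A n j : ℝ) / bprod D n (j + 1) =
      (A n j : ℝ) / bprod B n (j + 1) * g (n - 1 - j) / g n :=
    fun n j => digit_div_gauge h.pos hDpos hg0 hDg n _ j
  have hDlt : ∀ n, valS D n (A n) < 1 := fun n => by
    simp only [valS_eq, hdig]
    rw [tsum_div_const, div_lt_one (hg0 n)]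
    exact (hg n).2
  have hDs : ∀ n, ValSummable D n (A n) := fun n => by
    simp only [ValSummable, hdig]
    exact (hg n).1.div_const _
  have hDsup : IsSuper p A D := IsSuper.of_valS hDpos hDper hDs fun n => (hDlt n).le
  obtain ⟨μ, hμ, hμD⟩ := exists_uniform_lower_bound hp hDper (hDsup.one_lt hten)
  obtain ⟨v, hv1, hvμ⟩ := exists_between hμ
  obtain ⟨u, hu, huA⟩ := exists_scale hp
    (c := fun n j => (A n j : ℝ) / bprod D n (j + 1))
    (fun n j => digit_div_nonneg hDpos n _ j)
    (fun n => by simp only [hAp, bprod_add_period hDper]) hv1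
    (fun n => summable_bounded (one_pos.trans hv1) hvμ hμD (hC n) n) hDlt
  have hu0 : 0 < u := one_pos.trans hu
  have hscale : ∀ n (j : ℕ), (A n j : ℝ) / bprod (fun n => D n / u) n (j + 1) =
      (A n j : ℝ) / bprod D n (j + 1) * u ^ (j + 1) := fun n j => by
    have : bprod (fun n => D n / u) n (j + 1) = bprod D n (j + 1) / u ^ (j + 1) := by
      simp [bprod, prod_div_distrib]
    rw [this, div_div_eq_mul_div, div_mul_eq_mul_div]
  refine ⟨fun n => D n / u, IsSuper.of_valS (fun n => div_pos (hDpos n) hu0)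
    (fun n => by simp only [hDper]) (fun n => ?_) (fun n => ?_), ?_⟩
  · simp only [ValSummable, hscale]
    exact (huA n).1
  · simp only [valS_eq, hscale]
    exact (huA n).2
  · have hprod : ∏ i ∈ range p, D i = ∏ i ∈ range p, B i := by
      have htel : ∀ m : ℕ, ∏ i ∈ range m, D i = (∏ i ∈ range m, B i) * (g m / g 0) := by
        intro m
        induction m with
        | zero => simp [(hg0 0).ne']
        | succ m ih =>
          rw [prod_range_succ, prod_range_succ, ih]
          have := hg0 m
          simp only [hD]
          push_cast
          field_simp
      have hgp0 := hgp 0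
      rw [zero_add] at hgp0
      rw [htel, hgp0, div_self (hg0 0).ne', mul_one]
    rw [prod_div_distrib, hprod, prod_const, card_range]
    exact div_lt_self (prod_pos fun _ _ => h.pos _) (one_lt_pow₀ hu (by omega))

lemma exists_minimal_isSuper (hp : 1 ≤ p) (hC : ∀ n j, A n j ≤ C) (hA0 : ∀ n, 1 ≤ A n 0) :
    ∃ B, IsSuper p A B ∧
      ∀ B', IsSuper p A B' → ∏ i ∈ range p, B i ≤ ∏ i ∈ range p, B' i := by
  set D : ℝ := (C + 1) ^ p with hD
  set box : Set (ℤ → ℝ) := Set.pi Set.univ fun _ => Set.Icc 1 D with hbox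
  have hboxc : IsCompact box := isCompact_univ_pi fun _ => isCompact_Icc
  set K : Set (ℤ → ℝ) := box ∩ ((⋂ n : ℤ, {B | B (n + p) = B n}) ∩
    ⋂ n : ℤ, ⋂ N : ℕ, box ∩ (fun B => ∑ j ∈ range N, (A n j : ℝ) / bprod B n (j + 1)) ⁻¹'
      Set.Iic 1) with hK
  have hone : ∀ B ∈ box, ∀ n, 0 < B n := fun B hB n => one_pos.trans_le (hB n (Set.mem_univ n)).1
  have hKc : IsCompact K := by
    refine hboxc.inter_right (IsClosed.inter ?_ ?_)
    · exact isClosed_iInter fun n => isClosed_eq (continuous_apply _) (continuous_apply _)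
    · refine isClosed_iInter fun n => isClosed_iInter fun N =>
        ContinuousOn.preimage_isClosed_of_isClosed ?_ hboxc.isClosed isClosed_Iic
      refine continuousOn_finsetSum _ fun j _ => ?_
      refine continuousOn_const.div (Continuous.continuousOn ?_)
        fun B hB => (bprod_pos (hone B hB) n (j + 1)).ne'
      exact continuous_finsetProd _ fun i _ => continuous_apply _
  have hKsuper : ∀ B ∈ K, IsSuper p A B := by
    rintro B ⟨h1, h2, h3⟩
    rw [Set.mem_iInter] at h2
    refine ⟨hone B h1, h2, fun n N => ?_⟩
    simp only [Set.mem_iInter] at h3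
    exact (h3 n N).2
  have hsuperK : ∀ B, IsSuper p A B → ∏ i ∈ range p, B i ≤ D → B ∈ K := by
    intro B hB hle
    have h1 := hB.one_le hA0
    have hmem : B ∈ box := by
      intro n _
      refine ⟨h1 n, le_trans ?_ hle⟩
      obtain ⟨h2, h3⟩ := periodic_toNat hp hB.periodic n
      rw [← h3, ← prod_erase_mul _ _ (mem_range.2 h2)]
      refine le_mul_of_one_le_left (hB.pos _).le ?_
      simpa using prod_le_prod (s := (range p).erase (n % p).toNat) (f := fun _ => (1 : ℝ))
        (g := fun i : ℕ => B i) (fun _ _ => zero_le_one) fun i _ => h1 i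
    refine ⟨hmem, Set.mem_iInter.2 hB.periodic, ?_⟩
    simp only [Set.mem_iInter]
    exact fun n N => ⟨hmem, hB.partial_le n N⟩
  have hconst := hsuperK _ (IsSuper.of_const hC) (by simp [hD])
  obtain ⟨B, hBK, hmin⟩ := hKc.exists_isMinOn ⟨_, hconst⟩
    (f := fun B : ℤ → ℝ => ∏ i ∈ range p, B i)
    (continuous_finsetProd _ fun (i : ℕ) _ => continuous_apply (i : ℤ)).continuousOn
  refine ⟨B, hKsuper B hBK, fun B' hB' => ?_⟩
  by_cases hle : ∏ i ∈ range p, B' i ≤ D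
  · exact hmin (hsuperK B' hB' hle)
  · have h1 := hmin hconst
    simp only [Set.mem_ofPred_eq, prod_const, card_range] at h1
    exact h1.trans (not_le.1 hle).le

/-- Existence of a base in which each of the sequences `A n` has value `1`. -/
lemma exists_base (hp : 1 ≤ p) (hC : ∀ n j, A n j ≤ C)
    (hten : ∀ n, lexLt tenOmega (A n)) (hA0 : ∀ n, 1 ≤ A n 0) (hAp : ∀ n, A (n + p) = A n) :
    ∃ B : ℤ → ℝ, (∀ n, 1 < B n) ∧ (∀ n, B (n + p) = B n) ∧ ∀ n, valS B n (A n) = 1 := by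
  obtain ⟨B, hB, hmin⟩ := exists_minimal_isSuper hp hC hA0
  refine ⟨B, hB.one_lt hten, hB.periodic, fun n => (hB.valS_le_one n).antisymm ?_⟩
  refine le_of_not_gt fun hlt => ?_
  obtain ⟨B', hB', hlt'⟩ := exists_isSuper_prod_lt hp hC hten hA0 hAp hB hlt
  exact absurd (hmin B' hB') (not_le.2 hlt')

end Existence

theorem stmt16 (p : ℕ) (hp : 1 ≤ p)
    (a : ℕ → ℕ → ℕ)  -- `a i j` is the digit `a_{i,j+1}`
    (hlex10 : ∀ i < p, lexLt tenOmega (a i))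
    (hcond : ∀ i < p,
      (EvZero (a i) → ∀ j : ℕ, 1 ≤ j →
        lexLt (fun m => a i (m + j)) (a ((((i : ℤ) - j) % (p : ℤ)).toNat))) ∧
      (¬ EvZero (a i) → ∀ j : ℕ, 1 ≤ j →
        lexLe (fun m => a i (m + j)) (a ((((i : ℤ) - j) % (p : ℤ)).toNat)))) :
    ∃ β : ℤ → ℝ,
      ((∀ n, 1 < β n) ∧ (∀ n, β (n + p) = β n) ∧
        (∀ i < p, (EvZero (a i) → IsGreedyOne β i (a i)) ∧
                  (¬ EvZero (a i) → IsQuasiGreedyOne β i (a i)))) ∧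
      ((∀ i < p, UltPer (a i)) →
        ∀ β' : ℤ → ℝ,
          ((∀ n, 1 < β' n) ∧ (∀ n, β' (n + p) = β' n) ∧
            (∀ i < p, (EvZero (a i) → IsGreedyOne β' i (a i)) ∧
                      (¬ EvZero (a i) → IsQuasiGreedyOne β' i (a i)))) →
          β' = β) ∧
      ((∀ i < p, 2 ≤ a i 0) →
        ∀ β' : ℤ → ℝ,
          ((∀ n, 1 < β' n) ∧ (∀ n, β' (n + p) = β' n) ∧
            (∀ i < p, (EvZero (a i) → IsGreedyOne β' i (a i)) ∧
                      (¬ EvZero (a i) → IsQuasiGreedyOne β' i (a i)))) →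
          β' = β) := by
  set A : ℤ → ℕ → ℕ := fun n => a (n % p).toNat with hA
  have hp0 : (p : ℤ) ≠ 0 := by omega
  have hAp : ∀ n, A (n + p) = A n := fun n => by simp only [hA, Int.add_emod_right]
  have hidx : ∀ n : ℤ, (n % p).toNat < p ∧ (((n % p).toNat : ℕ) : ℤ) = n % p := fun n => by
    have h1 := Int.emod_nonneg n hp0
    have h2 := Int.emod_lt_of_pos n (b := p) (by omega)
    omega
  have hAi : ∀ i < p, A i = a i := fun i hi => by
    simp only [hA]
    rw [Int.emod_eq_of_lt (by omega) (by omega), Int.toNat_natCast]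
  have hshift : ∀ (n : ℤ) (j : ℕ),
      a (((((n % p).toNat : ℕ) : ℤ) - j) % (p : ℤ)).toNat = A (n - j) := fun n j => by
    simp only [hA]
    rw [(hidx n).2, Int.emod_sub_emod]
  have hlex : ∀ (n : ℤ) (j : ℕ), lexLe (tailSeq j (A n)) (A (n - j)) := by
    intro n j
    rcases Nat.eq_zero_or_pos j with rfl | hj
    · rw [Nat.cast_zero, sub_zero]
      exact Or.inl rfl
    · have h := hcond _ (hidx n).1
      by_cases hz : EvZero (a (n % p).toNat)
      · have h1 := h.1 hz j hj
        rw [hshift] at h1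
        exact Or.inr h1
      · have h1 := h.2 hz j hj
        rw [hshift] at h1
        exact h1
  have hten : ∀ n, lexLt tenOmega (A n) := fun n => hlex10 _ (hidx n).1
  have hA0 : ∀ n, 1 ≤ A n 0 := fun n => by
    simpa [tenOmega] using (show lexLe tenOmega (A n) from Or.inr (hten n)).head_le
  have hC : ∀ n j, A n j ≤ (Finset.range p).sup fun i => a i 0 := fun n j => by
    have h1 := (hlex n j).head_le
    simp only [tailSeq, zero_add] at h1
    exact h1.trans
      (Finset.le_sup (f := fun i => a i 0) (Finset.mem_range.2 (hidx (n - j)).1))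
  obtain ⟨β, hβ1, hβp, hβv⟩ := exists_base hp hC hten hA0 hAp
  have hβ0 : ∀ n, 0 < β n := fun n => one_pos.trans (hβ1 n)
  obtain ⟨μ, hμ, hμβ⟩ := exists_uniform_lower_bound hp hβp hβ1
  have huniq : ∀ β' : ℤ → ℝ,
      ((∀ n, 1 < β' n) ∧ (∀ n, β' (n + p) = β' n) ∧
        (∀ i < p, (EvZero (a i) → IsGreedyOne β' i (a i)) ∧
                  (¬ EvZero (a i) → IsQuasiGreedyOne β' i (a i)))) → β' = β := by
    rintro β' ⟨h1, h2, h3⟩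
    refine base_unique hp hβ0 (fun n => one_pos.trans (h1 n)) hβp h2 hA0 hβv fun n => ?_
    have hval : valS β' ((n % p).toNat : ℕ) (A n) = 1 := by
      by_cases hz : EvZero (a (n % p).toNat)
      · exact ((h3 _ (hidx n).1).1 hz).1
      · exact ((h3 _ (hidx n).1).2 hz).2.1
    have hper : ∀ m, valS β' (m + p) (A n) = valS β' m (A n) := fun m => by
      simp only [valS_eq, bprod_add_period h2]
    rw [← hval]
    exact (periodic_toNat hp (f := fun m => valS β' m (A n)) hper n).2.symm
  refine ⟨β, ⟨hβ1, hβp, fun i hi => ⟨fun hz => ?_, fun hz => ?_⟩⟩, fun _ => huniq,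
    fun _ => huniq⟩
  · rw [← hAi i hi] at hz ⊢
    refine isGreedyOne_of_lex hβ0 hβv i (fun j hj => ?_) hz
    rw [hAi i hi] at hz ⊢
    exact (hcond i hi).1 hz j hj
  · rw [← hAi i hi] at hz ⊢
    exact isQuasiGreedyOne_of_lex hμ hμβ hC hβv i (hlex i) hz
end
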